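/- The quantum boson algebra B_q(g) is presented as the Q(q)-algebra generated by {e_i', f_i | i∈I} subject to the relations: e_i' f_j = q^{−(α_i,α_j)} f_j e_i' + δ_{i,j} for all i,j; and, for i≠j with b_{ij} = 1 − c_{i,j}, the q-Serre relations Σ_{k=0}^{b_{ij}} (−1)^k [b_{ij} choose k]_{q_i} f_i^k f_j f_i^{b_{ij}−k} = 0 and Σ_{k=0}^{b_{ij}} (−1)^k [b_{ij} choose k]_{q_i} (e_i')^k e_j' (e_i')^{b_{ij}−k} = 0. That is, the natural surjection from the algebra with this presentation onto B_q(g), sending e_i' to e_i' and f_i to left multiplication by f_i, is an isomorphism. -/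

import Mathlib

/- Common setting: a symmetrizable generalized Cartan matrix, the field `𝕂 = ℚ(q)`
(with `q = qv`), quantum integers, the negative half `Uq A` of the quantum group
presented by the `q`-Serre relations, its weight spaces, and the root-lattice pairing. -/

set_option maxHeartbeats 1000000
set_option synthInstance.maxHeartbeats 400000

noncomputable section

structure GCM (I : Type) where
  c : I → I → ℤ
  d : I → ℤ
  d_pos : ∀ i, 0 < d i
  diag : ∀ i, c i i = 2
  offdiag : ∀ i j, i ≠ j → c i j ≤ 0
  dsymm : ∀ i j, d i * c i j = d j * c j i

abbrev 𝕂 : Type := RatFunc ℚ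

/-- The indeterminate `q`. -/
def qv : 𝕂 := RatFunc.X

def qNum (t : 𝕂) (n : ℕ) : 𝕂 := (t ^ n - t⁻¹ ^ n) / (t - t⁻¹)

def qFact (t : 𝕂) (n : ℕ) : 𝕂 := ∏ k ∈ Finset.range n, qNum t (k + 1)

def qBinom (t : 𝕂) (m k : ℕ) : 𝕂 := qFact t m / (qFact t k * qFact t (m - k))

variable {I : Type} [DecidableEq I]

/-- `q_i = q^{d_i}`. -/
def qd (A : GCM I) (i : I) : 𝕂 := qv ^ A.d i

/-- `ζ_i = 1 - q_i^2`. -/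
def ze (A : GCM I) (i : I) : 𝕂 := 1 - qd A i ^ 2

/-- The `q`-Serre element `Σ_{k=0}^{b_{ij}} (-1)^k [b_{ij} choose k]_{q_i} a^k b a^{b_{ij}-k}`
for elements `a, b` of any `𝕂`-algebra, where `b_{ij} = 1 - c_{ij}`. -/
def serreIn {R : Type} [Ring R] [Algebra 𝕂 R] (A : GCM I) (i j : I) (a b : R) : R :=
  ∑ k ∈ Finset.range ((1 - A.c i j).toNat + 1),
    ((-1 : 𝕂) ^ k * qBinom (qd A i) ((1 - A.c i j).toNat) k) •
      (a ^ k * b * a ^ ((1 - A.c i j).toNat - k))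

/-- The `q`-Serre relations. -/
inductive URel (A : GCM I) : FreeAlgebra 𝕂 I → FreeAlgebra 𝕂 I → Prop
  | serre (i j : I) (h : i ≠ j) :
      URel A (serreIn A i j (FreeAlgebra.ι 𝕂 i) (FreeAlgebra.ι 𝕂 j)) 0

/-- The negative half `U_q^-(g)`. -/
abbrev Uq (A : GCM I) : Type := RingQuot (URel A)

/-- The generator `f_i` of `U_q^-(g)`. -/
def fg (A : GCM I) (i : I) : Uq A :=
  RingQuot.mkAlgHom 𝕂 (URel A) (FreeAlgebra.ι 𝕂 i)

/-- The symmetric bilinear pairing on the root lattice, `(α_i, α_j) = d_i c_{ij}`. -/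
def ip (A : GCM I) (β γ : I →₀ ℤ) : ℤ :=
  β.sum fun i a => γ.sum fun j b => a * b * (A.d i * A.c i j)

/-- The simple root `α_i` as an element of the root lattice. -/
def sr (i : I) : I →₀ ℤ := Finsupp.single i 1

/-- The weight space of weight `β` of `U_q^-(g)`, where `wt (f_i) = -α_i`. -/
def Uwt (A : GCM I) (β : I →₀ ℤ) : Submodule 𝕂 (Uq A) :=
  Submodule.span 𝕂 {x | ∃ l : List I,
    -((l.map fun i => Finsupp.single i (1 : ℤ)).sum) = β ∧ x = (l.map (fg A)).prod}


/-- The quantum boson algebra `B_q(g)`. -/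
def Bqg (A : GCM I) (e' : I → Module.End 𝕂 (Uq A)) : Subalgebra 𝕂 (Module.End 𝕂 (Uq A)) :=
  Algebra.adjoin 𝕂 ((Set.range fun i => LinearMap.mul 𝕂 (Uq A) (fg A i)) ∪ Set.range e')

/-- The defining relations of the presented algebra: generators `e_i'` (encoded `Sum.inl i`)
and `f_i` (encoded `Sum.inr i`), subject to
`e_i' f_j = q^{-(α_i,α_j)} f_j e_i' + δ_{ij}` and the `q`-Serre relations in the `f`'s and
in the `e'`'s separately. -/
inductive BRel (A : GCM I) : FreeAlgebra 𝕂 (I ⊕ I) → FreeAlgebra 𝕂 (I ⊕ I) → Prop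
  | ef (i j : I) :
      BRel A (FreeAlgebra.ι 𝕂 (Sum.inl i) * FreeAlgebra.ι 𝕂 (Sum.inr j))
        (qv ^ (-(A.d i * A.c i j)) •
            (FreeAlgebra.ι 𝕂 (Sum.inr j) * FreeAlgebra.ι 𝕂 (Sum.inl i))
          + if i = j then 1 else 0)
  | serreF (i j : I) (h : i ≠ j) :
      BRel A (serreIn A i j (FreeAlgebra.ι 𝕂 (Sum.inr i)) (FreeAlgebra.ι 𝕂 (Sum.inr j))) 0
  | serreE (i j : I) (h : i ≠ j) :
      BRel A (serreIn A i j (FreeAlgebra.ι 𝕂 (Sum.inl i)) (FreeAlgebra.ι 𝕂 (Sum.inl j))) 0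

/-- The algebra presented by generators `{e_i', f_i | i ∈ I}` and the relations `BRel`. -/
abbrev Bpres (A : GCM I) : Type := RingQuot (BRel A)

/-- Generators of the presented algebra. -/
def bgen (A : GCM I) (x : I ⊕ I) : Bpres A :=
  RingQuot.mkAlgHom 𝕂 (BRel A) (FreeAlgebra.ι 𝕂 x)

set_option linter.unusedSectionVars false

open scoped TensorProduct

lemma TensorProduct.eq_zero_of_contract {k U V : Type} [Field k] [AddCommGroup U] [Module k U]
    [AddCommGroup V] [Module k V] (t : U ⊗[k] V)
    (h : ∀ φ : V →ₗ[k] k, TensorProduct.rid k U (TensorProduct.map LinearMap.id φ t) = 0) :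
    t = 0 := by
  classical
  let b := Module.Basis.ofVectorSpace k V
  apply (TensorProduct.equivFinsuppOfBasisRight (M := U) b).injective
  rw [map_zero]
  ext i
  rw [Finsupp.zero_apply, ← h (b.coord i)]
  clear h
  induction t with
  | zero => simp
  | tmul u v => simp
  | add x y hx hy =>
    simp only [map_add, Finsupp.add_apply, hx, hy]

/-- A ring `U` generated by elements `f i`, graded by multisets of indices, together with a
reversal map, a counit and skew derivations `e i`; the iterated `q`-commutators of `f i` with
`f j` for `i ≠ j` vanish eventually. -/
structure BosonDatum (k U I : Type) [Field k] [Ring U] [Algebra k U] [DecidableEq I] where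
  q : k
  q_ne : q ≠ 0
  q_pow : ∀ n : ℤ, q ^ n = 1 → n = 0
  p : I → I → ℤ
  p_symm : ∀ i j, p i j = p j i
  p_pos : ∀ i, 0 < p i i
  f : I → U
  span_words : Submodule.span k (Set.range fun l : List I => (l.map f).prod) = ⊤
  scale : (Multiset I → k) → U →ₗ[k] U
  scale_words : ∀ κ (l : List I), scale κ (l.map f).prod = κ l • (l.map f).prod
  separated : ∀ x, (∀ β, scale (fun γ => if γ = β then 1 else 0) x = 0) → x = 0
  star : U →ₗ[k] U
  star_words : ∀ l : List I, star (l.map f).prod = (l.reverse.map f).prod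
  counit : U →ₗ[k] k
  counit_words : ∀ l : List I, counit (l.map f).prod = if l = [] then 1 else 0
  e : I → Module.End k U
  e_one : ∀ i, e i 1 = 0
  e_f_mul : ∀ i j u, e i (f j * u) = (if i = j then u else 0) + q ^ (-p i j) • (f j * e i u)
  nilpotent : ∀ i j, i ≠ j → ∃ N, ((LinearMap.mulLeft k (f i) - LinearMap.mulRight k (f i) ∘ₗ
    scale (fun β => q ^ (β.map (p i)).sum) : Module.End k U) ^ N) (f j) = 0

namespace BosonDatum

variable {k U : Type} [Field k] [Ring U] [Algebra k U] (D : BosonDatum k U I)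

/-- The product of generators along a list. -/
def word (l : List I) : U := (l.map D.f).prod

@[simp] lemma word_nil : D.word [] = 1 := rfl

lemma word_cons (i : I) (l : List I) : D.word (i :: l) = D.f i * D.word l := by simp [word]

lemma word_append (l m : List I) : D.word (l ++ m) = D.word l * D.word m := by simp [word]

lemma word_concat (l : List I) (i : I) : D.word (l ++ [i]) = D.word l * D.f i := by simp [word]

@[simp] lemma scale_word (κ : Multiset I → k) (l : List I) :
    D.scale κ (D.word l) = κ l • D.word l := D.scale_words κ l

@[simp] lemma star_word (l : List I) : D.star (D.word l) = D.word l.reverse := D.star_words l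

@[simp] lemma counit_word (l : List I) : D.counit (D.word l) = if l = [] then 1 else 0 :=
  D.counit_words l

lemma hom_ext {M : Type} [AddCommGroup M] [Module k M] {φ ψ : U →ₗ[k] M}
    (h : ∀ l, φ (D.word l) = ψ (D.word l)) : φ = ψ := by
  apply LinearMap.ext_on_range D.span_words
  exact h

/-- To prove a linear identity it is enough to check words. -/
lemma eq_of_words {M : Type} [AddCommGroup M] [Module k M] (φ ψ : U →ₗ[k] M)
    (h : ∀ l, φ (D.word l) = ψ (D.word l)) (u : U) : φ u = ψ u := by
  rw [D.hom_ext h]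

@[simp] lemma counit_one : D.counit 1 = 1 := by simpa using D.counit_word []

@[simp] lemma star_one : D.star 1 = 1 := by simpa using D.star_word []

lemma scale_one (κ : Multiset I → k) : D.scale κ 1 = κ 0 • 1 := by simpa using D.scale_word κ []

lemma counit_f_mul (i : I) (u : U) : D.counit (D.f i * u) = 0 :=
  D.eq_of_words (D.counit ∘ₗ LinearMap.mulLeft k (D.f i)) 0
    (fun l => by simp [← word_cons]) u

lemma scale_f_mul (κ : Multiset I → k) (i : I) (u : U) :
    D.scale κ (D.f i * u) = D.f i * D.scale (fun β => κ (i ::ₘ β)) u :=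
  D.eq_of_words (D.scale κ ∘ₗ LinearMap.mulLeft k (D.f i))
    (LinearMap.mulLeft k (D.f i) ∘ₗ D.scale (fun β => κ (i ::ₘ β)))
    (fun l => by simp [← word_cons]) u

lemma scale_mul_f (κ : Multiset I → k) (i : I) (u : U) :
    D.scale κ (u * D.f i) = D.scale (fun β => κ (i ::ₘ β)) u * D.f i :=
  D.eq_of_words (D.scale κ ∘ₗ LinearMap.mulRight k (D.f i))
    (LinearMap.mulRight k (D.f i) ∘ₗ D.scale (fun β => κ (i ::ₘ β)))
    (fun l => by
      have : ((l ++ [i] : List I) : Multiset I) = i ::ₘ (l : Multiset I) := by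
        rw [Multiset.cons_coe, Multiset.coe_eq_coe]
        exact List.perm_append_singleton i l
      simp [← word_concat, this]) u

lemma scale_scale (κ μ : Multiset I → k) (u : U) :
    D.scale κ (D.scale μ u) = D.scale (fun β => κ β * μ β) u :=
  D.eq_of_words (D.scale κ ∘ₗ D.scale μ) (D.scale (fun β => κ β * μ β))
    (fun l => by simp [smul_smul, mul_comm]) u

lemma scale_smul (c : k) (κ : Multiset I → k) (u : U) :
    D.scale (fun β => c * κ β) u = c • D.scale κ u :=
  D.eq_of_words (D.scale (fun β => c * κ β)) (c • D.scale κ) (fun l => by simp [smul_smul]) u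

lemma scale_const_one (u : U) : D.scale (fun _ => 1) u = u :=
  D.eq_of_words (D.scale (fun _ => 1)) LinearMap.id (fun l => by simp) u

lemma star_star (u : U) : D.star (D.star u) = u :=
  D.eq_of_words (D.star ∘ₗ D.star) LinearMap.id (fun l => by simp) u

lemma star_scale (κ : Multiset I → k) (u : U) :
    D.star (D.scale κ u) = D.scale κ (D.star u) :=
  D.eq_of_words (D.star ∘ₗ D.scale κ) (D.scale κ ∘ₗ D.star) (fun l => by simp) u

lemma star_mul_f (i : I) (u : U) : D.star (u * D.f i) = D.f i * D.star u :=
  D.eq_of_words (D.star ∘ₗ LinearMap.mulRight k (D.f i)) (LinearMap.mulLeft k (D.f i) ∘ₗ D.star)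
    (fun l => by simp [← word_concat, ← word_cons]) u

lemma star_f_mul (i : I) (u : U) : D.star (D.f i * u) = D.star u * D.f i := by
  conv_lhs => rw [← D.star_star u]
  rw [← star_mul_f, star_star]

lemma e_scale (i : I) (κ : Multiset I → k) (u : U) :
    D.e i (D.scale κ u) = D.scale (fun β => κ (i ::ₘ β)) (D.e i u) := by
  refine D.eq_of_words (D.e i ∘ₗ D.scale κ) (D.scale (fun β => κ (i ::ₘ β)) ∘ₗ D.e i)
    (fun l => ?_) u
  simp only [LinearMap.comp_apply]
  induction l generalizing κ with
  | nil => simp [scale_one, e_one]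
  | cons j l ih =>
    have h := ih (fun β => κ (j ::ₘ β))
    simp only [scale_word, map_smul] at h
    simp only [scale_word, map_smul, word_cons, e_f_mul, map_add, scale_f_mul]
    simp only [Multiset.cons_swap i j, ← h]
    split_ifs with hij
    · subst hij; simp [smul_smul, mul_comm]
    · simp [smul_smul, mul_comm]

/-- The pairing of the simple root `i` with the weight `β`. -/
def pair (i : I) (β : Multiset I) : ℤ := (β.map (D.p i)).sum

@[simp] lemma pair_cons (i j : I) (β : Multiset I) : D.pair i (j ::ₘ β) = D.p i j + D.pair i β := by
  simp [pair]

@[simp] lemma pair_zero (i : I) : D.pair i 0 = 0 := by simp [pair]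

/-- The automorphism multiplying an element of weight `-β` by `q ^ (-(α_i, β))`. -/
def twist (i : I) : U →ₗ[k] U := D.scale (fun β => D.q ^ (-D.pair i β))

/-- The inverse of `twist i`. -/
def untwist (i : I) : U →ₗ[k] U := D.scale (fun β => D.q ^ D.pair i β)

@[simp] lemma twist_one (i : I) : D.twist i 1 = 1 := by simp [twist, scale_one]

@[simp] lemma untwist_one (i : I) : D.untwist i 1 = 1 := by simp [untwist, scale_one]

lemma twist_f_mul (i j : I) (u : U) :
    D.twist i (D.f j * u) = D.q ^ (-D.p i j) • (D.f j * D.twist i u) := by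
  simp only [twist, scale_f_mul, pair_cons, neg_add, zpow_add₀ D.q_ne, scale_smul, mul_smul_comm]

lemma twist_mul_f (i j : I) (u : U) :
    D.twist i (u * D.f j) = D.q ^ (-D.p i j) • (D.twist i u * D.f j) := by
  simp only [twist, scale_mul_f, pair_cons, neg_add, zpow_add₀ D.q_ne, scale_smul, smul_mul_assoc]

lemma untwist_f_mul (i j : I) (u : U) :
    D.untwist i (D.f j * u) = D.q ^ (D.p i j) • (D.f j * D.untwist i u) := by
  simp only [untwist, scale_f_mul, pair_cons, zpow_add₀ D.q_ne, scale_smul, mul_smul_comm]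

lemma untwist_mul_f (i j : I) (u : U) :
    D.untwist i (u * D.f j) = D.q ^ (D.p i j) • (D.untwist i u * D.f j) := by
  simp only [untwist, scale_mul_f, pair_cons, zpow_add₀ D.q_ne, scale_smul, smul_mul_assoc]

lemma twist_untwist (i : I) (u : U) : D.twist i (D.untwist i u) = u := by
  simp only [twist, untwist, scale_scale, ← zpow_add₀ D.q_ne, neg_add_cancel, zpow_zero,
    scale_const_one]

lemma untwist_twist (i : I) (u : U) : D.untwist i (D.twist i u) = u := by
  simp only [twist, untwist, scale_scale, ← zpow_add₀ D.q_ne, add_neg_cancel, zpow_zero,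
    scale_const_one]

lemma e_twist (i j : I) (u : U) : D.e i (D.twist j u) = D.q ^ (-D.p j i) • D.twist j (D.e i u) := by
  simp only [twist, e_scale, pair_cons, neg_add, zpow_add₀ D.q_ne, scale_smul]

lemma e_untwist (i j : I) (u : U) :
    D.e i (D.untwist j u) = D.q ^ (D.p j i) • D.untwist j (D.e i u) := by
  simp only [untwist, e_scale, pair_cons, zpow_add₀ D.q_ne, scale_smul]

lemma untwist_mul (i : I) (u v : U) : D.untwist i (u * v) = D.untwist i u * D.untwist i v := by
  refine D.eq_of_words (D.untwist i ∘ₗ LinearMap.mulRight k v)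
    (LinearMap.mulRight k (D.untwist i v) ∘ₗ D.untwist i) (fun l => ?_) u
  simp only [LinearMap.comp_apply, LinearMap.mulRight_apply]
  induction l with
  | nil => simp
  | cons j l ih => simp [word_cons, mul_assoc, untwist_f_mul, ih]

lemma e_mul (i : I) (u v : U) : D.e i (u * v) = D.e i u * v + D.twist i u * D.e i v := by
  refine D.eq_of_words (D.e i ∘ₗ LinearMap.mulRight k v)
    (LinearMap.mulRight k v ∘ₗ D.e i + LinearMap.mulRight k (D.e i v) ∘ₗ D.twist i) (fun l => ?_) u
  simp only [LinearMap.comp_apply, LinearMap.mulRight_apply, LinearMap.add_apply]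
  induction l with
  | nil => simp [e_one]
  | cons j l ih =>
    simp only [word_cons, mul_assoc, e_f_mul, ih, twist_f_mul, mul_add, add_mul, smul_add,
      smul_mul_assoc, ite_mul, zero_mul, add_assoc]

/-- The right-handed skew derivation. -/
def eStar (i : I) : Module.End k U := D.star ∘ₗ D.e i ∘ₗ D.star

lemma eStar_mul_f (i j : I) (u : U) : D.eStar i (u * D.f j) =
    (if i = j then u else 0) + D.q ^ (-D.p i j) • (D.eStar i u * D.f j) := by
  simp only [eStar, LinearMap.comp_apply, star_mul_f, e_f_mul, map_add, map_smul, star_f_mul]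
  split_ifs <;> simp [star_star]

lemma eStar_one (i : I) : D.eStar i 1 = 0 := by simp [eStar, e_one]

lemma eStar_f_mul (i j : I) (u : U) : D.eStar i (D.f j * u) =
    D.f j * D.eStar i u + (if i = j then D.twist i u else 0) := by
  refine D.eq_of_words (D.eStar i ∘ₗ LinearMap.mulLeft k (D.f j))
    (LinearMap.mulLeft k (D.f j) ∘ₗ D.eStar i + (if i = j then D.twist i else 0))
    (fun l => ?_) u |>.trans ?_
  · simp only [LinearMap.comp_apply, LinearMap.mulLeft_apply, LinearMap.add_apply]
    induction l using List.reverseRecOn with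
    | nil =>
      have := D.eStar_mul_f i j 1
      simp only [one_mul, eStar_one, zero_mul, smul_zero, add_zero] at this
      simp only [word_nil, mul_one, eStar_one, mul_zero, zero_add, this]
      split_ifs <;> simp
    | append_singleton l m ih =>
      simp only [word_concat, ← mul_assoc, eStar_mul_f, ih, mul_add, add_mul, smul_add]
      simp only [mul_smul_comm, mul_assoc]
      split_ifs <;> simp [twist_mul_f, add_assoc]
  · simp only [LinearMap.comp_apply, LinearMap.mulLeft_apply, LinearMap.add_apply]
    split_ifs <;> simp

lemma eStar_scale (i : I) (κ : Multiset I → k) (u : U) :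
    D.eStar i (D.scale κ u) = D.scale (fun β => κ (i ::ₘ β)) (D.eStar i u) := by
  simp [eStar, star_scale, e_scale]

lemma eStar_untwist (i j : I) (u : U) :
    D.eStar i (D.untwist j u) = D.q ^ (D.p j i) • D.untwist j (D.eStar i u) := by
  simp only [untwist, eStar_scale, pair_cons, zpow_add₀ D.q_ne, scale_smul]

lemma e_eStar (i j : I) (u : U) : D.e j (D.eStar i u) = D.eStar i (D.e j u) := by
  refine D.eq_of_words (D.e j ∘ₗ D.eStar i) (D.eStar i ∘ₗ D.e j) (fun l => ?_) u
  simp only [LinearMap.comp_apply]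
  induction l with
  | nil => simp [e_one, eStar_one]
  | cons m l ih =>
    simp only [word_cons, eStar_f_mul, e_f_mul, map_add, map_smul, ih]
    by_cases h : i = m
    · subst h
      simp only [if_true, e_twist, D.p_symm i j, smul_add]
      split_ifs <;> simp [add_assoc]
    · simp only [if_neg h, map_zero, add_zero]
      split_ifs <;> simp

/-- The `q`-commutator with `f i`. -/
def ad (i : I) : Module.End k U :=
  LinearMap.mulLeft k (D.f i) - LinearMap.mulRight k (D.f i) ∘ₗ D.untwist i

lemma ad_apply (i : I) (u : U) : D.ad i u = D.f i * u - D.untwist i u * D.f i := by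
  simp [ad]

lemma e_f_self (i : I) : D.e i (D.f i) = 1 := by
  simpa [e_one] using D.e_f_mul i i 1

lemma e_ad {i : I} {u : U} (h : D.e i u = 0) : D.e i (D.ad i u) = 0 := by
  simp [ad_apply, e_mul, h, e_untwist, twist_untwist, e_f_self]

lemma eStar_ad (i : I) (u : U) :
    D.eStar i (D.ad i u) = D.ad i (D.eStar i u) + (D.twist i u - D.untwist i u) := by
  have : D.q ^ D.p i i ≠ 0 := zpow_ne_zero _ D.q_ne
  simp only [ad_apply, map_sub, eStar_f_mul, eStar_mul_f, if_true, eStar_untwist, smul_mul_assoc,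
    smul_smul, zpow_neg, inv_mul_cancel₀ this, one_smul]
  abel

lemma ad_mul (i : I) (u v : U) : D.ad i (u * v) = D.ad i u * v + D.untwist i u * D.ad i v := by
  simp only [ad_apply, untwist_mul, sub_mul, mul_sub, mul_assoc]
  abel

lemma ad_untwist (i : I) (u : U) :
    D.ad i (D.untwist i u) = D.q ^ (-D.p i i) • D.untwist i (D.ad i u) := by
  have : D.q ^ D.p i i ≠ 0 := zpow_ne_zero _ D.q_ne
  simp only [ad_apply, map_sub, untwist_f_mul, untwist_mul_f, smul_sub, smul_smul, zpow_neg,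
    inv_mul_cancel₀ this, one_smul]

lemma ad_pow_untwist (i : I) (n : ℕ) (u : U) (h : (D.ad i ^ n) u = 0) :
    (D.ad i ^ n) (D.untwist i u) = 0 := by
  induction n generalizing u with
  | zero => simp_all
  | succ n ih =>
    rw [pow_succ, Module.End.mul_apply] at h ⊢
    rw [ad_untwist, map_smul, ih _ h, smul_zero]

lemma ad_pow_mul (i : I) (a b : ℕ) (u v : U) (hu : (D.ad i ^ a) u = 0) (hv : (D.ad i ^ b) v = 0) :
    (D.ad i ^ (a + b)) (u * v) = 0 := by
  induction hn : a + b generalizing a b u v with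
  | zero =>
    obtain ⟨rfl, rfl⟩ : a = 0 ∧ b = 0 := by omega
    simp_all
  | succ n ih =>
    rw [pow_succ, Module.End.mul_apply, ad_mul, map_add]
    have h1 : (D.ad i ^ n) (D.ad i u * v) = 0 := by
      cases a with
      | zero => simp_all
      | succ a =>
        rw [pow_succ, Module.End.mul_apply] at hu
        exact ih a b _ _ hu hv (by omega)
    have h2 : (D.ad i ^ n) (D.untwist i u * D.ad i v) = 0 := by
      cases b with
      | zero => simp_all
      | succ b =>
        rw [pow_succ, Module.End.mul_apply] at hv
        exact ih a b _ _ (D.ad_pow_untwist i a u hu) hv (by omega)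
    rw [h1, h2, add_zero]

/-- The elements killed by `e i` on which `ad i` acts nilpotently. -/
def nil (i : I) : Submodule k U := LinearMap.ker (D.e i) ⊓ (D.ad i).maxGenEigenspace 0

lemma mem_nil {i : I} {u : U} : u ∈ D.nil i ↔ D.e i u = 0 ∧ ∃ N, (D.ad i ^ N) u = 0 := by
  simp [nil, Module.End.mem_maxGenEigenspace]

lemma one_mem_nil (i : I) : 1 ∈ D.nil i :=
  D.mem_nil.2 ⟨D.e_one i, 1, by simp [ad_apply]⟩

lemma f_mul_mem_nil {i j : I} (hij : i ≠ j) {u : U} (hu : u ∈ D.nil i) :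
    D.f j * u ∈ D.nil i := by
  obtain ⟨h1, N, hN⟩ := D.mem_nil.1 hu
  obtain ⟨M, hM⟩ := D.nilpotent i j hij
  exact D.mem_nil.2 ⟨by simp [e_f_mul, h1, hij], M + N, D.ad_pow_mul i M N _ _ hM hN⟩

lemma ad_mem_nil {i : I} {u : U} (hu : u ∈ D.nil i) : D.ad i u ∈ D.nil i := by
  obtain ⟨h1, N, hN⟩ := D.mem_nil.1 hu
  refine D.mem_nil.2 ⟨D.e_ad h1, N, ?_⟩
  rw [← Module.End.mul_apply, ← pow_succ, pow_succ', Module.End.mul_apply, hN, map_zero]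

lemma untwist_mem_nil {i : I} {u : U} (hu : u ∈ D.nil i) : D.untwist i u ∈ D.nil i := by
  obtain ⟨h1, N, hN⟩ := D.mem_nil.1 hu
  exact D.mem_nil.2 ⟨by simp [e_untwist, h1], N, D.ad_pow_untwist i N u hN⟩

lemma iSup_nil_mul_pow (i : I) :
    ⨆ n : ℕ, (D.nil i).map (LinearMap.mulRight k (D.f i ^ n)) = ⊤ := by
  set W := ⨆ n : ℕ, (D.nil i).map (LinearMap.mulRight k (D.f i ^ n)) with hW
  have mem : ∀ n u, u ∈ D.nil i → u * D.f i ^ n ∈ W := fun n u hu =>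
    Submodule.mem_iSup_of_mem n ⟨u, hu, rfl⟩
  have stable : ∀ j u, u ∈ W → D.f j * u ∈ W := by
    intro j u hu
    refine Submodule.iSup_induction _ (motive := fun u => D.f j * u ∈ W) hu ?_ (by simp)
      (fun x y hx hy => by rw [mul_add]; exact W.add_mem hx hy)
    rintro n _ ⟨v, hv, rfl⟩
    rw [LinearMap.mulRight_apply, ← mul_assoc]
    by_cases hij : i = j
    · subst hij
      have : D.f i * v = D.ad i v + D.untwist i v * D.f i := by simp [ad_apply]
      rw [this, add_mul, mul_assoc, ← pow_succ']
      exact W.add_mem (mem _ _ (D.ad_mem_nil hv)) (mem _ _ (D.untwist_mem_nil hv))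
    · exact mem _ _ (D.f_mul_mem_nil hij hv)
  rw [eq_top_iff, ← D.span_words, Submodule.span_le]
  rintro _ ⟨l, rfl⟩
  change D.word l ∈ W
  induction l with
  | nil => simpa using mem 0 1 (D.one_mem_nil i)
  | cons j l ih => rw [word_cons]; exact stable j _ ih

lemma q_zpow_ne_one {n : ℤ} (hn : n ≠ 0) : D.q ^ n ≠ 1 := fun h => hn (D.q_pow n h)

lemma e_f_pow (i : I) (n : ℕ) : ∃ c : k, c ≠ 0 ∧ D.e i (D.f i ^ (n + 1)) = c • D.f i ^ n := by
  set z := D.q ^ (-D.p i i) with hz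
  refine ⟨∑ j ∈ Finset.range (n + 1), z ^ j, ?_, ?_⟩
  · intro h
    have := geom_sum_mul z (n + 1)
    rw [h, zero_mul] at this
    refine D.q_zpow_ne_one (n := -D.p i i * (n + 1 : ℕ)) ?_ ?_
    · exact mul_ne_zero (neg_ne_zero.2 (D.p_pos i).ne') (by positivity)
    · rw [zpow_mul, zpow_natCast, ← hz]
      exact (sub_eq_zero.1 this.symm)
  · induction n with
    | zero => simp [e_f_self]
    | succ n ih =>
      rw [pow_succ', e_f_mul, if_pos rfl, ih, ← hz, mul_smul_comm, ← pow_succ', smul_smul,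
        Finset.sum_range_succ' _ (n + 1), Finset.mul_sum, pow_zero, add_smul, one_smul, add_comm]
      simp only [pow_succ']

lemma e_sum_mul_pow (i : I) : ∃ c : ℕ → k, (∀ n, c n ≠ 0) ∧ ∀ (M : ℕ) (v : ℕ → U),
    (∀ n, D.e i (v n) = 0) → D.e i (∑ n ∈ Finset.range (M + 1), v n * D.f i ^ n) =
      ∑ n ∈ Finset.range M, (c n • D.twist i (v (n + 1))) * D.f i ^ n := by
  choose c hc0 hc using D.e_f_pow i
  refine ⟨c, hc0, fun M v hv => ?_⟩
  rw [Finset.sum_range_succ']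
  simp [e_mul, hv, hc]

lemma eq_zero_of_sum_mul_pow (i : I) (M : ℕ) (v : ℕ → U) (hv : ∀ n, D.e i (v n) = 0)
    (h : ∑ n ∈ Finset.range M, v n * D.f i ^ n = 0) : ∀ n < M, v n = 0 := by
  obtain ⟨c, hc0, hc⟩ := D.e_sum_mul_pow i
  induction M generalizing v with
  | zero => simp
  | succ M ih =>
    have h1 := hc M v hv
    rw [h, map_zero] at h1
    have h2 := ih (fun n => c n • D.twist i (v (n + 1))) (fun n => by simp [e_twist, hv]) h1.symm
    have h3 : ∀ n < M, v (n + 1) = 0 := fun n hn => by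
      have := (smul_eq_zero.1 (h2 n hn)).resolve_left (hc0 n)
      rw [← D.untwist_twist i (v (n + 1)), this, map_zero]
    intro n hn
    cases n with
    | succ n => exact h3 n (by omega)
    | zero =>
      rw [Finset.sum_range_succ', Finset.sum_eq_zero
        (fun n hn => by rw [h3 n (Finset.mem_range.1 hn), zero_mul])] at h
      simpa using h

lemma mem_nil_of_e_eq_zero {i : I} {x : U} (hx : D.e i x = 0) : x ∈ D.nil i := by
  have hmem : x ∈ ⨆ n : ℕ, (D.nil i).map (LinearMap.mulRight k (D.f i ^ n)) := by
    rw [iSup_nil_mul_pow]; trivial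
  rw [Submodule.mem_iSup_iff_exists_finsupp] at hmem
  obtain ⟨g, hg, hsum⟩ := hmem
  choose v hv hvg using hg
  obtain ⟨M, hM⟩ : ∃ M, g.support ⊆ Finset.range (M + 1) := by
    obtain ⟨M, hM⟩ := g.support.exists_nat_subset_range
    exact ⟨M, hM.trans (Finset.range_mono (by omega))⟩
  have hxs : x = ∑ n ∈ Finset.range (M + 1), v n * D.f i ^ n := by
    rw [← hsum, Finsupp.sum_of_support_subset _ hM _ (by simp)]
    exact Finset.sum_congr rfl (fun n _ => (hvg n).symm)
  obtain ⟨c, hc0, hc⟩ := D.e_sum_mul_pow i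
  have hv0 : ∀ n, D.e i (v n) = 0 := fun n => (D.mem_nil.1 (hv n)).1
  have h1 := hc M v hv0
  rw [← hxs, hx] at h1
  have h2 := D.eq_zero_of_sum_mul_pow i M _ (fun n => by simp [e_twist, hv0]) h1.symm
  have h3 : ∀ n < M, v (n + 1) = 0 := fun n hn => by
    have := (smul_eq_zero.1 (h2 n hn)).resolve_left (hc0 n)
    rw [← D.untwist_twist i (v (n + 1)), this, map_zero]
  rw [hxs, Finset.sum_range_succ', Finset.sum_eq_zero
    (fun n hn => by rw [h3 n (Finset.mem_range.1 hn), zero_mul])]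
  simpa using hv 0

/-- `x` is homogeneous of weight `-β`. -/
def IsWeight (β : Multiset I) (x : U) : Prop := ∀ κ, D.scale κ x = κ β • x

variable {D} in
lemma IsWeight.ad {β : Multiset I} {x : U} (h : D.IsWeight β x) (i : I) :
    D.IsWeight (i ::ₘ β) (D.ad i x) := by
  intro κ
  have hu : D.untwist i x = D.q ^ D.pair i β • x := h _
  rw [ad_apply, hu, map_sub, smul_mul_assoc, map_smul, scale_f_mul, scale_mul_f, h]
  simp only [mul_smul_comm, smul_mul_assoc, smul_sub, smul_comm (κ (i ::ₘ β))]

variable {D} in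
lemma IsWeight.ad_pow {β : Multiset I} {x : U} (h : D.IsWeight β x) (i : I) (n : ℕ) :
    D.IsWeight (Multiset.replicate n i + β) ((D.ad i ^ n) x) := by
  induction n with
  | zero => simpa using h
  | succ n ih =>
    rw [pow_succ', Module.End.mul_apply, Multiset.replicate_succ, Multiset.cons_add]
    exact ih.ad i

lemma eStar_ad_pow {β : Multiset I} {x : U} (h : D.IsWeight β x) {i : I}
    (hx : D.eStar i x = 0) (n : ℕ) :
    D.eStar i ((D.ad i ^ (n + 1)) x) = (∑ j ∈ Finset.range (n + 1),
      ((D.q ^ D.pair i β)⁻¹ * (D.q ^ D.p i i)⁻¹ ^ j - D.q ^ D.pair i β * (D.q ^ D.p i i) ^ j)) •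
        (D.ad i ^ n) x := by
  have hpair : ∀ n : ℕ, D.q ^ D.pair i (Multiset.replicate n i + β) =
      D.q ^ D.pair i β * (D.q ^ D.p i i) ^ n := fun n => by
    rw [← zpow_natCast, ← zpow_mul, ← zpow_add₀ D.q_ne]
    congr 1
    simp [pair]
    ring
  have key : ∀ n : ℕ, D.twist i ((D.ad i ^ n) x) - D.untwist i ((D.ad i ^ n) x) =
      ((D.q ^ D.pair i β)⁻¹ * (D.q ^ D.p i i)⁻¹ ^ n - D.q ^ D.pair i β * (D.q ^ D.p i i) ^ n) •
        (D.ad i ^ n) x := fun n => by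
    rw [twist, untwist, h.ad_pow i n, h.ad_pow i n, ← sub_smul, zpow_neg, hpair, mul_inv, inv_pow]
  induction n with
  | zero =>
    have := key 0
    rw [pow_zero, Module.End.one_apply] at this
    simp [eStar_ad, hx, this]
  | succ n ih =>
    rw [pow_succ', Module.End.mul_apply, eStar_ad, ih, key, map_smul, ← Module.End.mul_apply,
      ← pow_succ', ← add_smul, ← Finset.sum_range_succ _ (n + 1)]

lemma sum_inv_sub_mul {x z : k} (hx : x ≠ 0) (hz : z ≠ 0) (n : ℕ) :
    (∑ j ∈ Finset.range (n + 1), (x⁻¹ * z⁻¹ ^ j - x * z ^ j)) * (z - 1) =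
      (z ^ (n + 1) - 1) * (x⁻¹ * z⁻¹ ^ n - x) := by
  induction n with
  | zero => simp; ring
  | succ n ih =>
    rw [Finset.sum_range_succ, add_mul, ih]
    simp only [inv_pow]
    field_simp
    ring

/-- A nonzero homogeneous element killed by both skew derivations attached to `i` has weight
pairing nonpositively with the simple root `i`. -/
lemma pair_nonpos {β : Multiset I} {x : U} (h : D.IsWeight β x) (hx : x ≠ 0) {i : I}
    (he : D.e i x = 0) (hs : D.eStar i x = 0) : D.pair i β ≤ 0 := by
  by_contra! hpos
  obtain ⟨-, N, hN⟩ := D.mem_nil.1 (D.mem_nil_of_e_eq_zero he)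
  classical
  have hex : ∃ N, (D.ad i ^ N) x = 0 := ⟨N, hN⟩
  have hmin := Nat.find_spec hex
  obtain ⟨n, hn⟩ : ∃ n, Nat.find hex = n + 1 := Nat.exists_eq_succ_of_ne_zero (by
    intro h0
    rw [h0, pow_zero] at hmin
    exact hx hmin)
  have hne : (D.ad i ^ n) x ≠ 0 := Nat.find_min hex (by omega)
  rw [hn] at hmin
  have h1 := D.eStar_ad_pow h hs n
  rw [hmin, map_zero] at h1
  have h2 := (smul_eq_zero.1 h1.symm).resolve_right hne
  have hp := D.p_pos i
  have hx0 : D.q ^ D.pair i β ≠ 0 := zpow_ne_zero _ D.q_ne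
  have hz0 : D.q ^ D.p i i ≠ 0 := zpow_ne_zero _ D.q_ne
  have h3 := sum_inv_sub_mul hx0 hz0 n
  rw [h2, zero_mul, eq_comm, mul_eq_zero, sub_eq_zero, sub_eq_zero] at h3
  rcases h3 with h3 | h3
  · rw [← zpow_natCast, ← zpow_mul] at h3
    exact D.q_zpow_ne_one (by positivity) h3
  · rw [inv_pow, ← mul_inv] at h3
    have h4 : D.q ^ (D.pair i β + (D.pair i β + D.p i i * n)) = 1 := by
      rw [zpow_add₀ D.q_ne, zpow_add₀ D.q_ne, zpow_mul, zpow_natCast]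
      nth_rewrite 1 [← h3]
      exact inv_mul_cancel₀ (mul_ne_zero hx0 (pow_ne_zero _ hz0))
    exact D.q_zpow_ne_one (by positivity) h4

/-- Left multiplication by the coproduct of `f i`. -/
def copStep (i : I) : Module.End k (U ⊗[k] U) :=
  TensorProduct.map (LinearMap.mulLeft k (D.f i)) LinearMap.id +
    TensorProduct.map (D.twist i) (LinearMap.mulLeft k (D.f i))

lemma copStep_tmul (i : I) (u v : U) :
    D.copStep i (u ⊗ₜ v) = (D.f i * u) ⊗ₜ v + D.twist i u ⊗ₜ (D.f i * v) := by
  simp [copStep]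

/-- The coproduct of a word. -/
def cop : List I → U ⊗[k] U
  | [] => 1 ⊗ₜ 1
  | i :: l => D.copStep i (cop l)

/-- The graph of the coproduct. -/
def copGraph : Submodule k (U × U ⊗[k] U) :=
  Submodule.span k (Set.range fun l => (D.word l, D.cop l))

/-- The operator `e` along a list. -/
def eWord (w : List I) : Module.End k U := (w.map D.e).prod

@[simp] lemma eWord_nil : D.eWord [] = 1 := rfl

lemma eWord_cons (i : I) (w : List I) : D.eWord (i :: w) = D.e i * D.eWord w := by simp [eWord]

lemma eWord_append (w v : List I) : D.eWord (w ++ v) = D.eWord w * D.eWord v := by simp [eWord]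

lemma word_mem_copGraph (l : List I) : (D.word l, D.cop l) ∈ D.copGraph :=
  Submodule.subset_span ⟨l, rfl⟩

lemma step_mem_copGraph (i : I) {x : U × U ⊗[k] U} (hx : x ∈ D.copGraph) :
    (D.f i * x.1, D.copStep i x.2) ∈ D.copGraph := by
  have : D.copGraph ≤ D.copGraph.comap ((LinearMap.mulLeft k (D.f i)).prodMap (D.copStep i)) := by
    rw [copGraph, Submodule.span_le]
    rintro _ ⟨l, rfl⟩
    exact Submodule.subset_span ⟨i :: l, by simp [word_cons, cop]⟩
  exact this hx

lemma map_e_copStep (i j : I) (t : U ⊗[k] U) :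
    TensorProduct.map (D.e i) LinearMap.id (D.copStep j t) = (if i = j then t else 0) +
      D.q ^ (-D.p i j) • D.copStep j (TensorProduct.map (D.e i) LinearMap.id t) := by
  induction t with
  | zero => simp
  | tmul u v =>
    simp only [copStep_tmul, map_add, TensorProduct.map_tmul, e_f_mul, LinearMap.id_apply, e_twist,
      TensorProduct.add_tmul, TensorProduct.smul_tmul', smul_add, D.p_symm j i]
    split_ifs <;> simp [add_assoc]
  | add x y hx hy =>
    simp only [map_add, hx, hy, smul_add]
    split_ifs <;> abel

lemma e_mem_copGraph (i : I) {x : U × U ⊗[k] U} (hx : x ∈ D.copGraph) :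
    (D.e i x.1, TensorProduct.map (D.e i) LinearMap.id x.2) ∈ D.copGraph := by
  have : D.copGraph ≤ D.copGraph.comap
      ((D.e i).prodMap (TensorProduct.map (D.e i) LinearMap.id)) := by
    conv_lhs => rw [copGraph]
    rw [Submodule.span_le]
    rintro _ ⟨l, rfl⟩
    change (D.e i (D.word l), TensorProduct.map (D.e i) LinearMap.id (D.cop l)) ∈ D.copGraph
    induction l with
    | nil =>
      have : ((0 : U), (0 : U ⊗[k] U)) ∈ D.copGraph := Submodule.zero_mem _
      simpa [cop, e_one] using this
    | cons j l ih =>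
      rw [word_cons, e_f_mul, cop, map_e_copStep]
      have h1 := D.copGraph.smul_mem (D.q ^ (-D.p i j)) (D.step_mem_copGraph j ih)
      split_ifs
      · exact D.copGraph.add_mem (D.word_mem_copGraph l) h1
      · simpa using h1
  exact this hx

lemma eWord_mem_copGraph (w : List I) {x : U × U ⊗[k] U} (hx : x ∈ D.copGraph) :
    (D.eWord w x.1, TensorProduct.map (D.eWord w) LinearMap.id x.2) ∈ D.copGraph := by
  induction w with
  | nil =>
    have : TensorProduct.map (1 : Module.End k U) (LinearMap.id : U →ₗ[k] U) = LinearMap.id :=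
      TensorProduct.map_id
    simpa [this] using hx
  | cons i w ih =>
    have := D.e_mem_copGraph i ih
    rw [eWord_cons, Module.End.mul_eq_comp]
    rwa [← LinearMap.comp_apply (TensorProduct.map _ _), ← TensorProduct.map_comp,
      LinearMap.id_comp] at this

lemma counit_twist (i : I) (u : U) : D.counit (D.twist i u) = D.counit u :=
  D.eq_of_words (D.counit ∘ₗ D.twist i) D.counit (fun l => by
    simp only [LinearMap.comp_apply, twist, scale_word, map_smul, counit_word]
    split_ifs with h <;> simp [h]) u

lemma counit_map_of_mem_copGraph {x : U × U ⊗[k] U} (hx : x ∈ D.copGraph) :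
    TensorProduct.lid k U (TensorProduct.map D.counit LinearMap.id x.2) = x.1 := by
  have step : ∀ i t, TensorProduct.lid k U (TensorProduct.map D.counit LinearMap.id
      (D.copStep i t)) =
      D.f i * TensorProduct.lid k U (TensorProduct.map D.counit LinearMap.id t) := by
    intro i t
    induction t with
    | zero => simp
    | tmul u v => simp [copStep_tmul, counit_f_mul, counit_twist]
    | add x y hx hy => simp only [map_add, hx, hy, mul_add]
  have : D.copGraph ≤ LinearMap.eqLocus
      ((TensorProduct.lid k U).toLinearMap ∘ₗ TensorProduct.map D.counit LinearMap.id ∘ₗ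
        LinearMap.snd k U (U ⊗[k] U)) (LinearMap.fst k U (U ⊗[k] U)) := by
    rw [copGraph, Submodule.span_le]
    rintro _ ⟨l, rfl⟩
    change TensorProduct.lid k U (TensorProduct.map D.counit LinearMap.id (D.cop l)) = D.word l
    induction l with
    | nil => simp [cop]
    | cons i l ih => rw [cop, step, ih, word_cons]
  exact this hx

lemma counit_eWord_contract (w : List I) (φ : U →ₗ[k] k) {x : U × U ⊗[k] U}
    (hx : x ∈ D.copGraph) :
    D.counit (D.eWord w (TensorProduct.rid k U (TensorProduct.map LinearMap.id φ x.2))) =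
      φ (D.eWord w x.1) := by
  have h := D.counit_map_of_mem_copGraph (D.eWord_mem_copGraph w hx)
  simp only at h
  rw [← h]
  clear h hx
  generalize x.2 = t
  induction t with
  | zero => simp
  | tmul u v => simp [mul_comm]
  | add x y hx hy => simp only [map_add, hx, hy]

/-- The projection onto the part of height `n`. -/
def ht (n : ℕ) : U →ₗ[k] U := D.scale (fun β => if β.card = n then 1 else 0)

lemma ht_word (n : ℕ) (l : List I) : D.ht n (D.word l) = if l.length = n then D.word l else 0 := by
  rw [ht, scale_word, Multiset.coe_card]
  split_ifs <;> simp

lemma ht_zero (u : U) : D.ht 0 u = D.counit u • 1 :=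
  D.eq_of_words (D.ht 0) (D.counit.smulRight 1) (fun l => by
    cases l <;> simp [ht, scale_one]) u

lemma ht_f_mul (n : ℕ) (i : I) (u : U) : D.ht (n + 1) (D.f i * u) = D.f i * D.ht n u := by
  simp [ht, scale_f_mul]

lemma ht_twist (n : ℕ) (i : I) (u : U) : D.ht n (D.twist i u) = D.twist i (D.ht n u) := by
  simp [ht, twist, scale_scale, mul_comm]

lemma ht_e {n : ℕ} {x : U} (h : D.ht (n + 1) x = x) (i : I) : D.ht n (D.e i x) = D.e i x := by
  conv_rhs => rw [← h]
  simp [ht, e_scale]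

lemma ht_eStar {n : ℕ} {x : U} (h : D.ht (n + 1) x = x) (i : I) :
    D.ht n (D.eStar i x) = D.eStar i x := by
  conv_rhs => rw [← h]
  simp [ht, eStar_scale]

lemma ht_ht (n : ℕ) (u : U) : D.ht n (D.ht n u) = D.ht n u := by
  rw [ht, scale_scale]
  congr 2
  funext β
  split_ifs <;> simp

lemma eq_zero_of_ht {x : U} (h : ∀ n, D.ht n x = 0) : x = 0 := by
  refine D.separated x fun β => ?_
  have : D.scale (fun γ => if γ = β then 1 else 0) (D.ht β.card x) =
      D.scale (fun γ => if γ = β then 1 else 0) x := by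
    rw [ht, scale_scale]
    congr 2
    funext γ
    by_cases hγ : γ = β <;> simp [hγ]
  rw [← this, h, map_zero]

lemma eWord_scale (w : List I) (κ : Multiset I → k) (u : U) :
    D.eWord w (D.scale κ u) = D.scale (fun γ => κ (w + γ)) (D.eWord w u) := by
  induction w with
  | nil => simp
  | cons i w ih =>
    rw [eWord_cons, Module.End.mul_apply, ih, e_scale]
    simp [← Multiset.cons_coe]

lemma counit_scale (κ : Multiset I → k) (u : U) : D.counit (D.scale κ u) = κ 0 * D.counit u :=
  D.eq_of_words (D.counit ∘ₗ D.scale κ) (κ 0 • D.counit) (fun l => by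
    simp only [LinearMap.comp_apply, scale_word, map_smul, LinearMap.smul_apply, counit_word]
    split_ifs with h <;> simp [h]) u

lemma counit_eWord_scale (w : List I) (κ : Multiset I → k) (u : U) :
    D.counit (D.eWord w (D.scale κ u)) = κ w * D.counit (D.eWord w u) := by
  rw [eWord_scale, counit_scale, add_zero]

/-- There are no nonzero elements of height `n` killed by all the `e i`. -/
def NoConstants (n : ℕ) : Prop := ∀ x, D.ht n x = x → (∀ i, D.e i x = 0) → x = 0

lemma eq_zero_of_counit_eWord {n : ℕ} (hn : ∀ m, 1 ≤ m → m ≤ n → D.NoConstants m) {x : U}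
    (hx : D.ht n x = x) (h : ∀ w, D.counit (D.eWord w x) = 0) : x = 0 := by
  induction n generalizing x with
  | zero =>
    rw [← hx, ht_zero]
    have := h []
    simp_all
  | succ n ih =>
    refine hn (n + 1) (by omega) le_rfl x hx fun i => ?_
    refine ih (fun m h1 h2 => hn m h1 (by omega)) (D.ht_e hx i) fun w => ?_
    rw [← Module.End.mul_apply]
    simpa [eWord_append, eWord_cons] using h (w ++ [i])

lemma map_ht_cop {n : ℕ} {l : List I} (h : l.length ≤ n) :
    TensorProduct.map (D.ht n) LinearMap.id (D.cop l) =
      if l.length = n then D.word l ⊗ₜ 1 else 0 := by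
  have step : ∀ i n t, TensorProduct.map (D.ht (n + 1)) LinearMap.id (D.copStep i t) =
      TensorProduct.map (LinearMap.mulLeft k (D.f i)) LinearMap.id
        (TensorProduct.map (D.ht n) LinearMap.id t) +
      TensorProduct.map (D.twist i) (LinearMap.mulLeft k (D.f i))
        (TensorProduct.map (D.ht (n + 1)) LinearMap.id t) := by
    intro i n t
    induction t with
    | zero => simp
    | tmul u v => simp [copStep_tmul, ht_f_mul, ht_twist]
    | add x y hx hy => simp only [map_add, hx, hy]; abel
  induction l generalizing n with
  | nil =>
    rcases n with _ | n
    · simp [cop, ht_zero]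
    · simp [cop, ht, scale_one]
  | cons i l ih =>
    rcases n with _ | n
    · simp at h
    · simp only [List.length_cons, add_le_add_iff_right] at h
      rw [cop, step, ih h, ih (by omega), if_neg (show ¬ l.length = n + 1 by omega), map_zero,
        add_zero]
      simp only [List.length_cons, add_left_inj]
      split_ifs <;> simp [word_cons]

/-- The part of the graph of the coproduct spanned by words of length `n`. -/
def copGraphOf (n : ℕ) : Submodule k (U × U ⊗[k] U) :=
  Submodule.span k ((fun l => (D.word l, D.cop l)) '' {l | l.length = n})

lemma copGraphOf_le (n : ℕ) : D.copGraphOf n ≤ D.copGraph :=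
  Submodule.span_mono (Set.image_subset_range _ _)

lemma exists_mem_copGraphOf {n : ℕ} {x : U} (h : D.ht n x = x) :
    ∃ t, (x, t) ∈ D.copGraphOf n := by
  have key : (⊤ : Submodule k U) ≤
      ((D.copGraphOf n).map (LinearMap.fst k U (U ⊗[k] U))).comap (D.ht n) := by
    rw [← D.span_words, Submodule.span_le]
    rintro _ ⟨l, rfl⟩
    change D.ht n (D.word l) ∈ (D.copGraphOf n).map (LinearMap.fst k U (U ⊗[k] U))
    rw [ht_word]
    split_ifs with hl
    · exact ⟨(D.word l, D.cop l), Submodule.subset_span ⟨l, hl, rfl⟩, rfl⟩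
    · exact Submodule.zero_mem _
  have hm := key (Submodule.mem_top : x ∈ ⊤)
  rw [Submodule.mem_comap, h] at hm
  obtain ⟨⟨y, t⟩, hy, rfl⟩ := hm
  exact ⟨t, hy⟩

lemma map_ht_of_mem_copGraphOf {n m : ℕ} (hnm : n ≤ m) {x : U × U ⊗[k] U}
    (hx : x ∈ D.copGraphOf n) : TensorProduct.map (D.ht m) LinearMap.id x.2 =
      if n = m then x.1 ⊗ₜ 1 else 0 := by
  have : D.copGraphOf n ≤ LinearMap.eqLocus
      (TensorProduct.map (D.ht m) LinearMap.id ∘ₗ LinearMap.snd k U (U ⊗[k] U))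
      (if n = m then (TensorProduct.mk k U U).flip 1 ∘ₗ LinearMap.fst k U (U ⊗[k] U) else 0) := by
    rw [copGraphOf, Submodule.span_le]
    rintro _ ⟨l, hl, rfl⟩
    have hl' : l.length = n := hl
    simp only [SetLike.mem_coe, LinearMap.mem_eqLocus, LinearMap.comp_apply, LinearMap.snd_apply]
    rw [map_ht_cop _ (by omega), hl']
    split_ifs <;> simp
  have h2 := this hx
  simp only [LinearMap.mem_eqLocus, LinearMap.comp_apply, LinearMap.snd_apply] at h2
  rw [h2]
  split_ifs <;> simp

/-- An element of least height killed by all the `e i` is primitive. -/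
lemma cop_of_constant {n : ℕ} (hn0 : n ≠ 0) (hn : ∀ m, 1 ≤ m → m < n → D.NoConstants m) {x : U}
    {t : U ⊗[k] U} (ht : (x, t) ∈ D.copGraphOf n) (hx : ∀ i, D.e i x = 0) :
    t = 1 ⊗ₜ x + x ⊗ₜ 1 := by
  have hG := D.copGraphOf_le n ht
  set κ : Multiset I → k := fun β => if β.card = 0 ∨ β.card = n then 0 else 1 with hκ
  have hw : ∀ w, w ≠ [] → D.eWord w x = 0 := by
    intro w hw
    obtain ⟨v, i, rfl⟩ := w.eq_nil_or_concat'.resolve_left hw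
    simp [eWord_append, eWord_cons, hx]
  have contract : ∀ (φ : U →ₗ[k] k) (ψ : U →ₗ[k] U) (t : U ⊗[k] U),
      TensorProduct.rid k U (TensorProduct.map LinearMap.id φ
        (TensorProduct.map ψ LinearMap.id t)) =
      ψ (TensorProduct.rid k U (TensorProduct.map LinearMap.id φ t)) := by
    intro φ ψ t
    induction t with
    | zero => simp
    | tmul u v => simp
    | add x y hx hy => simp only [map_add, hx, hy]
  have hmid : TensorProduct.map (D.scale κ) LinearMap.id t = 0 := by
    refine TensorProduct.eq_zero_of_contract _ fun φ => ?_
    rw [contract]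
    refine D.eq_zero_of_ht fun m => ?_
    set y := TensorProduct.rid k U (TensorProduct.map LinearMap.id φ t) with hy
    have hscale : D.ht m (D.scale κ y) = if m = 0 ∨ m = n then 0 else D.ht m y := by
      split_ifs with hm
      · have : (fun β : Multiset I => (if β.card = m then (1 : k) else 0) * κ β) =
            fun β => 0 * (1 : k) := by
          funext β
          by_cases hβ : β.card = m
          · simp only [hκ, hβ, if_pos hm, mul_zero, zero_mul]
          · simp [hβ]
        rw [BosonDatum.ht, scale_scale, this, scale_smul, zero_smul]
      · rw [BosonDatum.ht, scale_scale]
        congr 2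
        funext β
        by_cases hβ : β.card = m
        · simp only [hκ, hβ, if_neg hm, if_true, mul_one]
        · simp [hβ]
    rw [hscale]
    split_ifs with hm
    · rfl
    · push Not at hm
      rcases lt_or_gt_of_ne hm.2 with hlt | hgt
      · refine D.eq_zero_of_counit_eWord (n := m) (fun m' h1 h2 => hn m' h1 (by omega))
          (D.ht_ht m y) fun w => ?_
        rw [BosonDatum.ht, counit_eWord_scale, hy, D.counit_eWord_contract w φ hG]
        by_cases hw0 : w = []
        · subst hw0
          simp [hm.1.symm]
        · rw [hw w hw0]
          simp
      · have := D.map_ht_of_mem_copGraphOf hgt.le ht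
        rw [hy, ← contract, this, if_neg hgt.ne, map_zero, map_zero]
  have hsum : ∀ u, u = D.ht 0 u + D.ht n u + D.scale κ u := by
    refine D.eq_of_words LinearMap.id (D.ht 0 + D.ht n + D.scale κ) fun l => ?_
    simp only [LinearMap.add_apply, ht_word, scale_word, hκ, LinearMap.id_apply, Multiset.coe_card]
    by_cases h0 : l.length = 0
    · simp [h0, hn0.symm]
    · by_cases h1 : l.length = n <;> simp [h0, h1, hn0]
  have hsum' : t = TensorProduct.map (D.ht 0) LinearMap.id t +
      TensorProduct.map (D.ht n) LinearMap.id t + TensorProduct.map (D.scale κ) LinearMap.id t := by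
    rw [← LinearMap.add_apply, ← LinearMap.add_apply, ← TensorProduct.map_add_left,
      ← TensorProduct.map_add_left]
    have : D.ht 0 + D.ht n + D.scale κ = LinearMap.id := by
      ext u
      simpa using (hsum u).symm
    rw [this, TensorProduct.map_id, LinearMap.id_apply]
  have h0 : TensorProduct.map (D.ht 0) LinearMap.id t = 1 ⊗ₜ x := by
    have h1 := D.counit_map_of_mem_copGraph hG
    simp only at h1
    rw [← h1]
    generalize t = s
    induction s with
    | zero => simp
    | tmul u v => simp [ht_zero, TensorProduct.smul_tmul]
    | add x y hx hy => simp only [map_add, hx, hy, TensorProduct.tmul_add]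
  rw [hsum', hmid, add_zero, h0, D.map_ht_of_mem_copGraphOf le_rfl ht, if_pos rfl]

/-- Twice the sum of the pairings between distinct entries of `β`. -/
def cross (β : Multiset I) : ℤ := (β.map (D.pair · β)).sum - (β.map (fun i => D.p i i)).sum

lemma cross_cons (i : I) (β : Multiset I) :
    D.cross (i ::ₘ β) = D.cross β + D.pair i β * 2 := by
  have : (β.map (fun j => D.p j i)).sum = D.pair i β := by
    simp only [pair, D.p_symm _ i]
  simp only [cross, Multiset.map_cons, Multiset.sum_cons, pair_cons, Multiset.sum_map_add, this]
  ring

/-- The scalars of the antipode. -/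
def antiScalar (β : Multiset I) : k := (-1) ^ β.card * D.q ^ (-(D.cross β / 2))

lemma antiScalar_zero : D.antiScalar 0 = 1 := by simp [antiScalar, cross]

lemma antiScalar_cons (i : I) (β : Multiset I) :
    D.antiScalar (i ::ₘ β) = -1 * (D.antiScalar β * D.q ^ (-D.pair i β)) := by
  rw [antiScalar, cross_cons, Int.add_mul_ediv_right _ _ two_ne_zero, neg_add,
    zpow_add₀ D.q_ne, antiScalar, Multiset.card_cons, pow_succ]
  ring

/-- The antipode. -/
def antipode : U →ₗ[k] U := D.star ∘ₗ D.scale D.antiScalar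

lemma antipode_f_mul (i : I) (u : U) :
    D.antipode (D.f i * u) = -(D.antipode (D.twist i u) * D.f i) := by
  simp only [antipode, LinearMap.comp_apply, scale_f_mul, star_f_mul, antiScalar_cons, scale_smul,
    twist, scale_scale, map_smul]
  simp

/-- The map `u ⊗ v ↦ S u * v`, where `S` is the antipode. -/
def anti : U ⊗[k] U →ₗ[k] U := LinearMap.mul' k U ∘ₗ TensorProduct.map D.antipode LinearMap.id

lemma anti_copStep (i : I) (t : U ⊗[k] U) : D.anti (D.copStep i t) = 0 := by
  induction t with
  | zero => simp
  | tmul u v => simp [anti, copStep_tmul, antipode_f_mul, mul_assoc]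
  | add x y hx hy => simp only [map_add, hx, hy, add_zero]

lemma anti_of_mem_copGraphOf {n : ℕ} (hn : n ≠ 0) {x : U × U ⊗[k] U} (hx : x ∈ D.copGraphOf n) :
    D.anti x.2 = 0 := by
  have : D.copGraphOf n ≤ LinearMap.ker (D.anti ∘ₗ LinearMap.snd k U (U ⊗[k] U)) := by
    rw [copGraphOf, Submodule.span_le]
    rintro _ ⟨l, hl, rfl⟩
    change D.anti (D.cop l) = 0
    cases l with
    | nil => exact absurd hl.symm hn
    | cons i l => exact D.anti_copStep i _
  exact this hx

lemma eStar_eq_e_of_ht_one {x : U} (hx : D.ht 1 x = x) (i : I) : D.eStar i x = D.e i x := by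
  rw [← hx]
  refine D.eq_of_words (D.eStar i ∘ₗ D.ht 1) (D.e i ∘ₗ D.ht 1) (fun l => ?_) x
  simp only [LinearMap.comp_apply, ht_word]
  split_ifs with h
  · obtain ⟨j, rfl⟩ := List.length_eq_one_iff.mp h
    rw [word_cons, word_nil, eStar_f_mul, e_f_mul, eStar_one, e_one]
    simp
  · simp

lemma cross_neg {β : Multiset I} (hβ : β ≠ 0) (h : ∀ i, D.pair i β ≤ 0) : D.cross β < 0 := by
  have h1 : (β.map (D.pair · β)).sum ≤ 0 := by
    refine (Multiset.sum_le_card_nsmul _ 0 ?_).trans (by simp)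
    simp only [Multiset.mem_map]
    rintro _ ⟨i, -, rfl⟩
    exact h i
  have h2 : 0 < (β.map (fun i => D.p i i)).sum := by
    obtain ⟨i, hi⟩ := Multiset.exists_mem_of_ne_zero hβ
    obtain ⟨γ, rfl⟩ := Multiset.exists_cons_of_mem hi
    rw [Multiset.map_cons, Multiset.sum_cons]
    refine add_pos_of_pos_of_nonneg (D.p_pos i) (Multiset.sum_nonneg ?_)
    simp only [Multiset.mem_map]
    rintro _ ⟨j, -, rfl⟩
    exact (D.p_pos j).le
  simp only [cross]
  omega

lemma noConstants {n : ℕ} (hn : n ≠ 0) : D.NoConstants n := by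
  induction n using Nat.strong_induction_on with
  | _ n ih =>
  intro x hx he
  refine D.separated x fun β => ?_
  by_contra hne
  set y := D.scale (fun γ => if γ = β then 1 else 0) x with hy
  have hcard : β.card = n := by
    by_contra hc
    apply hne
    rw [hy, ← hx, ht, scale_scale]
    have : (fun γ : Multiset I => (if γ = β then (1 : k) else 0) * if γ.card = n then 1 else 0) =
        fun γ => 0 * 1 := by
      funext γ
      by_cases h : γ = β <;> simp [h, hc]
    rw [this, scale_smul, zero_smul]
  have hwt : D.IsWeight β y := by
    intro κ
    rw [hy, scale_scale, ← scale_smul]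
    congr 2
    funext γ
    by_cases h : γ = β <;> simp [h]
  have hyht : D.ht n y = y := by
    rw [ht, hwt, hcard]
    simp
  have hye : ∀ i, D.e i y = 0 := fun i => by rw [hy, e_scale, he, map_zero]
  have hys : ∀ i, D.eStar i y = 0 := by
    intro i
    obtain ⟨m, rfl⟩ := Nat.exists_eq_succ_of_ne_zero hn
    rcases Nat.eq_zero_or_pos m with rfl | hm
    · rw [D.eStar_eq_e_of_ht_one hyht, hye]
    · refine ih m (by omega) (by omega) _ (D.ht_eStar hyht i) fun j => ?_
      rw [e_eStar, hye, map_zero]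
  obtain ⟨t, ht⟩ := D.exists_mem_copGraphOf hyht
  have ht1 := D.cop_of_constant hn (fun m h1 h2 => ih m h2 (by omega)) ht hye
  have h0 := D.anti_of_mem_copGraphOf hn ht
  simp only at h0
  have h1 : y + D.antiScalar β • D.star y = 0 := by
    rw [ht1] at h0
    simpa [anti, antipode, scale_one, antiScalar_zero, hwt D.antiScalar] using h0
  have h2 : D.star y + D.antiScalar β • y = 0 := by
    simpa [star_star] using congrArg D.star h1
  have h3 : (1 - D.antiScalar β * D.antiScalar β) • y = 0 := by
    have : D.star y = -(D.antiScalar β • y) := eq_neg_of_add_eq_zero_left h2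
    rw [this, smul_neg, smul_smul] at h1
    rw [sub_smul, one_smul, sub_eq_add_neg, h1]
  have h4 : D.antiScalar β * D.antiScalar β = 1 :=
    (sub_eq_zero.mp ((smul_eq_zero.mp h3).resolve_right hne)).symm
  have h5 : D.q ^ (-(D.cross β / 2) + -(D.cross β / 2)) = 1 := by
    rw [zpow_add₀ D.q_ne, ← h4, antiScalar]
    have : ((-1 : k) ^ β.card) * (-1) ^ β.card = 1 := by
      rw [← mul_pow]; simp
    linear_combination -(D.q ^ (-(D.cross β / 2)) * D.q ^ (-(D.cross β / 2))) * this
  have h6 := D.q_pow _ h5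
  have hβ : β ≠ 0 := by
    rintro rfl
    exact hn (by simpa using hcard.symm)
  have h7 := D.cross_neg hβ fun i => D.pair_nonpos hwt hne (hye i) (hys i)
  omega

/-- The form `(u, word w) ↦ counit (eWord w.reverse u)` is nondegenerate. -/
lemma eq_zero_of_eWord {x : U} (h : ∀ w, D.counit (D.eWord w x) = 0) : x = 0 := by
  refine D.eq_zero_of_ht fun n => ?_
  refine D.eq_zero_of_counit_eWord (fun m h1 _ => D.noConstants (by omega)) (D.ht_ht n x)
    fun w => ?_
  rw [ht, counit_eWord_scale, h, mul_zero]

/-- The span of the pairs of a word and the functional it represents. -/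
def formGraph : Submodule k (U × (U →ₗ[k] k)) :=
  Submodule.span k (Set.range fun w => (D.word w, D.counit ∘ₗ D.eWord w.reverse))

lemma word_mem_formGraph (w : List I) :
    (D.word w, D.counit ∘ₗ D.eWord w.reverse) ∈ D.formGraph :=
  Submodule.subset_span ⟨w, rfl⟩

lemma apply_one_of_mem_formGraph {x : U × (U →ₗ[k] k)} (hx : x ∈ D.formGraph) :
    x.2 1 = D.counit x.1 := by
  have : D.formGraph ≤ LinearMap.eqLocus (LinearMap.applyₗ 1 ∘ₗ LinearMap.snd k U (U →ₗ[k] k))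
      (D.counit ∘ₗ LinearMap.fst k U (U →ₗ[k] k)) := by
    rw [formGraph, Submodule.span_le]
    rintro _ ⟨w, rfl⟩
    change D.counit (D.eWord w.reverse 1) = D.counit (D.word w)
    cases w with
    | nil => simp
    | cons i w => simp [eWord_append, eWord_cons, e_one]
  exact this hx

lemma cons_mem_formGraph (i : I) {x : U × (U →ₗ[k] k)} (hx : x ∈ D.formGraph) :
    (D.f i * x.1, x.2 ∘ₗ D.e i) ∈ D.formGraph := by
  have : D.formGraph ≤ D.formGraph.comap
      ((LinearMap.mulLeft k (D.f i)).prodMap ((D.e i).lcomp k k)) := by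
    conv_lhs => rw [formGraph]
    rw [Submodule.span_le]
    rintro _ ⟨w, rfl⟩
    have h := D.word_mem_formGraph (i :: w)
    have h2 : D.counit ∘ₗ D.eWord (i :: w).reverse = (D.counit ∘ₗ D.eWord w.reverse) ∘ₗ D.e i := by
      simp [eWord_append, eWord_cons, Module.End.mul_eq_comp, LinearMap.comp_assoc]
    rw [h2, word_cons] at h
    exact h
  exact this hx

lemma e_mem_formGraph (j : I) {x : U × (U →ₗ[k] k)} (hx : x ∈ D.formGraph) :
    (D.e j x.1, x.2 ∘ₗ LinearMap.mulLeft k (D.f j)) ∈ D.formGraph := by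
  have : D.formGraph ≤ D.formGraph.comap
      ((D.e j).prodMap ((LinearMap.mulLeft k (D.f j)).lcomp k k)) := by
    conv_lhs => rw [formGraph]
    rw [Submodule.span_le]
    rintro _ ⟨w, rfl⟩
    change (D.e j (D.word w), (D.counit ∘ₗ D.eWord w.reverse) ∘ₗ LinearMap.mulLeft k (D.f j)) ∈
      D.formGraph
    induction w with
    | nil =>
      convert Submodule.zero_mem _ using 1
      ext <;> simp [e_one, counit_f_mul]
    | cons i w ih =>
      have h1 := D.formGraph.smul_mem (D.q ^ (-D.p j i)) (D.cons_mem_formGraph i ih)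
      have h2 : (if j = i then (D.word w, D.counit ∘ₗ D.eWord w.reverse) else 0) ∈ D.formGraph := by
        split_ifs
        · exact D.word_mem_formGraph w
        · exact Submodule.zero_mem _
      convert D.formGraph.add_mem h2 h1 using 1
      refine Prod.ext ?_ (LinearMap.ext fun u => ?_)
      · rw [word_cons, e_f_mul]
        split_ifs <;> simp
      · simp only [List.reverse_cons, eWord_append, eWord_cons, eWord_nil, mul_one,
          LinearMap.comp_apply, LinearMap.mulLeft_apply, Module.End.mul_apply, e_f_mul,
          map_add, map_smul, Prod.snd_add, LinearMap.add_apply, D.p_symm j i]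
        by_cases h : i = j
        · simp [h]
        · simp [h, Ne.symm h]
  exact this hx

lemma apply_word_of_mem_formGraph {x : U × (U →ₗ[k] k)} (hx : x ∈ D.formGraph) (w : List I) :
    x.2 (D.word w) = D.counit (D.eWord w.reverse x.1) := by
  induction w generalizing x with
  | nil => simpa using D.apply_one_of_mem_formGraph hx
  | cons i w ih =>
    have := ih (D.e_mem_formGraph i hx)
    simpa [word_cons, eWord_append, eWord_cons] using this

lemma snd_eq_zero_of_mem_formGraph {φ : U →ₗ[k] k} (h : (0, φ) ∈ D.formGraph) : φ = 0 :=
  D.hom_ext fun w => by simpa using D.apply_word_of_mem_formGraph h w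

/-- Symmetry of the form. -/
lemma counit_eWord_word (w v : List I) :
    D.counit (D.eWord w.reverse (D.word v)) = D.counit (D.eWord v.reverse (D.word w)) := by
  simpa using D.apply_word_of_mem_formGraph (D.word_mem_formGraph w) v

/-- A linear relation between words gives the reversed relation between the operators `e`. -/
lemma sum_eWord_reverse_eq_zero {ι : Type} (s : Finset ι) (c : ι → k) (w : ι → List I)
    (h : ∑ a ∈ s, c a • D.word (w a) = 0) : ∑ a ∈ s, c a • D.eWord (w a).reverse = 0 := by
  ext u
  refine D.eq_zero_of_eWord fun v => ?_
  have h1 : ∑ a ∈ s, c a • (D.word (w a ++ v.reverse),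
      D.counit ∘ₗ D.eWord (w a ++ v.reverse).reverse) ∈ D.formGraph :=
    Submodule.sum_mem _ fun a _ => Submodule.smul_mem _ _ (D.word_mem_formGraph _)
  have h2 : ∑ a ∈ s, c a • (D.word (w a ++ v.reverse),
      D.counit ∘ₗ D.eWord (w a ++ v.reverse).reverse) =
      (0, ∑ a ∈ s, c a • (D.counit ∘ₗ D.eWord (w a ++ v.reverse).reverse)) := by
    refine Prod.ext ?_ ?_
    · simp only [Prod.fst_sum, Prod.smul_fst, word_append]
      simp only [← smul_mul_assoc, ← Finset.sum_mul, h, zero_mul]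
    · simp only [Prod.snd_sum, Prod.smul_snd]
  rw [h2] at h1
  have h3 := LinearMap.congr_fun (D.snd_eq_zero_of_mem_formGraph h1) u
  simpa [eWord_append, LinearMap.sum_apply, map_sum] using h3

lemma ht_eWord (n : ℕ) (w : List I) (u : U) :
    D.ht n (D.eWord w u) = D.eWord w (D.ht (w.length + n) u) := by
  rw [ht, ht, eWord_scale]
  simp

lemma eq_counit_smul_one {z : U} (h : ∀ n, n ≠ 0 → D.ht n z = 0) : z = D.counit z • 1 := by
  rw [← sub_eq_zero]
  refine D.eq_zero_of_ht fun n => ?_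
  rw [map_sub, map_smul]
  rcases eq_or_ne n 0 with rfl | hn
  · simp [ht_zero]
  · have : D.ht n 1 = 0 := by simpa [hn.symm] using D.ht_word n []
    simp [h n hn, this]

lemma counit_action_word {E : U →ₗ[k] Module.End k U}
    (hE : ∀ w, E (D.word w) = D.eWord w) (v : U) (w : List I) :
    D.counit (E v (D.word w)) = D.counit (D.eWord w.reverse (D.star v)) := by
  refine D.eq_of_words (D.counit ∘ₗ LinearMap.applyₗ (D.word w) ∘ₗ E)
    (D.counit ∘ₗ D.eWord w.reverse ∘ₗ D.star) (fun l => ?_) v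
  simp only [LinearMap.comp_apply, LinearMap.applyₗ_apply_apply, hE, star_word]
  simpa using D.counit_eWord_word l.reverse w

lemma ht_action_word {E : U →ₗ[k] Module.End k U}
    (hE : ∀ w, E (D.word w) = D.eWord w) (n : ℕ) (v : U) (w : List I) :
    D.ht n (E v (D.word w)) = if n ≤ w.length then E (D.ht (w.length - n) v) (D.word w) else 0 := by
  have := D.eq_of_words (D.ht n ∘ₗ LinearMap.applyₗ (D.word w) ∘ₗ E)
    (if n ≤ w.length then LinearMap.applyₗ (D.word w) ∘ₗ E ∘ₗ D.ht (w.length - n) else 0)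
    (fun l => ?_) v
  · simp only [LinearMap.comp_apply, LinearMap.applyₗ_apply_apply] at this
    rw [this]
    split_ifs <;> simp
  · simp only [LinearMap.comp_apply, LinearMap.applyₗ_apply_apply, hE, ht_eWord, ht_word]
    by_cases h : n ≤ w.length
    · rw [if_pos h]
      by_cases h2 : w.length = l.length + n
      · simp [h2, ht_word, hE]
      · simp [h2, ht_word, show ¬ l.length = w.length - n by omega]
    · simp [h, show ¬ w.length = l.length + n by omega]

lemma ht_eq_zero_of_action {E : U →ₗ[k] Module.End k U}
    (hE : ∀ w, E (D.word w) = D.eWord w) {ι : Type} (b : Module.Basis ι k U) (c : ι →₀ U)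
    (h : ∀ y, (c.sum fun i v => b i * E v y) = 0) (m : ℕ) (i : ι) : D.ht m (c i) = 0 := by
  induction m using Nat.strong_induction_on generalizing i with
  | _ m ih =>
  have key : ∀ w : List I, w.length = m → D.counit (E (c i) (D.word w)) = 0 := by
    intro w hw
    have h1 : ∀ i, E (c i) (D.word w) = D.counit (E (c i) (D.word w)) • 1 := by
      intro i
      refine D.eq_counit_smul_one fun n hn => ?_
      rw [D.ht_action_word hE]
      split_ifs with hnw
      · rw [ih _ (by omega) i]
        simp
      · rfl
    have h2 := h (D.word w)
    rw [Finsupp.sum] at h2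
    have h3 : ∑ i ∈ c.support, D.counit (E (c i) (D.word w)) • b i = 0 := by
      rw [← h2]
      refine Finset.sum_congr rfl fun i _ => ?_
      conv_rhs => rw [h1 i]
      simp
    by_cases hi : i ∈ c.support
    · exact linearIndependent_iff'.mp b.linearIndependent _ _ h3 i hi
    · simp [Finsupp.notMem_support_iff.mp hi]
  have h0 : D.star (D.ht m (c i)) = 0 := by
    refine D.eq_zero_of_eWord fun w => ?_
    rw [ht, star_scale, counit_eWord_scale, Multiset.coe_card]
    split_ifs with hw
    · rw [← w.reverse_reverse, ← D.counit_action_word hE, key _ (by simpa using hw), mul_zero]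
    · simp
  rw [← D.star_star (D.ht m (c i)), h0, map_zero]

variable {B : Type} [Ring B] [Algebra k B]

/-- The map `u ⊗ v ↦ F u * E v`. -/
def triangular (F E : U →ₐ[k] B) : U ⊗[k] U →ₗ[k] B :=
  LinearMap.mul' k B ∘ₗ TensorProduct.map F.toLinearMap E.toLinearMap

lemma triangular_surjective (F E : U →ₐ[k] B)
    (hgen : Algebra.adjoin k (Set.range (fun i => F (D.f i)) ∪ Set.range (fun i => E (D.f i))) = ⊤)
    (hcomm : ∀ i j, E (D.f i) * F (D.f j) =
      D.q ^ (-D.p i j) • (F (D.f j) * E (D.f i)) + if i = j then 1 else 0) :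
    Function.Surjective (triangular F E) := by
  have hEF : ∀ i u, E (D.f i) * F u = F (D.twist i u) * E (D.f i) + F (D.e i u) := by
    intro i u
    refine D.eq_of_words (LinearMap.mulLeft k (E (D.f i)) ∘ₗ F.toLinearMap)
      (LinearMap.mulRight k (E (D.f i)) ∘ₗ F.toLinearMap ∘ₗ D.twist i + F.toLinearMap ∘ₗ D.e i)
      (fun l => ?_) u
    simp only [LinearMap.comp_apply, LinearMap.mulLeft_apply, LinearMap.mulRight_apply,
      LinearMap.add_apply, AlgHom.toLinearMap_apply]
    induction l with
    | nil => simp [e_one]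
    | cons j l ih =>
      rw [word_cons, map_mul, ← mul_assoc, hcomm, add_mul, smul_mul_assoc, mul_assoc, ih,
        twist_f_mul, e_f_mul]
      split_ifs
      · simp [mul_add, mul_assoc]
        abel
      · simp [mul_add, mul_assoc]
  let S : Subalgebra k B :=
    { carrier := {x | ∀ r ∈ LinearMap.range (triangular F E),
        x * r ∈ LinearMap.range (triangular F E)}
      mul_mem' := fun {x y} hx hy r hr => by rw [mul_assoc]; exact hx _ (hy _ hr)
      add_mem' := fun {x y} hx hy r hr => by
        rw [add_mul]; exact Submodule.add_mem _ (hx _ hr) (hy _ hr)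
      algebraMap_mem' := fun c r hr => by
        rw [← Algebra.smul_def]; exact Submodule.smul_mem _ _ hr }
  have hS : S = ⊤ := by
    rw [eq_top_iff, ← hgen, Algebra.adjoin_le_iff]
    rintro _ (⟨i, rfl⟩ | ⟨i, rfl⟩) _ ⟨t, rfl⟩
    · refine ⟨TensorProduct.map (LinearMap.mulLeft k (D.f i)) LinearMap.id t, ?_⟩
      induction t with
      | zero => simp
      | tmul u v => simp [triangular, mul_assoc]
      | add x y hx hy => simp only [map_add, hx, hy, mul_add]
    · refine ⟨TensorProduct.map (D.twist i) (LinearMap.mulLeft k (D.f i)) t +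
        TensorProduct.map (D.e i) LinearMap.id t, ?_⟩
      induction t with
      | zero => simp
      | tmul u v => simp [triangular, ← mul_assoc, hEF, add_mul]
      | add x y hx hy =>
        simp only [map_add] at hx hy ⊢
        rw [mul_add, ← hx, ← hy]
        abel
  intro x
  have hx : x ∈ S := by rw [hS]; exact Algebra.mem_top
  have h1 := hx 1 ⟨1 ⊗ₜ 1, by simp [triangular]⟩
  rwa [mul_one] at h1

/-- An algebra generated by two copies of `U` with the boson commutation relations acts
faithfully on `U`. -/
lemma injective_of_triangular (F E : U →ₐ[k] B)
    (hgen : Algebra.adjoin k (Set.range (fun i => F (D.f i)) ∪ Set.range (fun i => E (D.f i))) = ⊤)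
    (hcomm : ∀ i j, E (D.f i) * F (D.f j) =
      D.q ^ (-D.p i j) • (F (D.f j) * E (D.f i)) + if i = j then 1 else 0)
    (a : B →ₐ[k] Module.End k U) (haF : ∀ i, a (F (D.f i)) = LinearMap.mulLeft k (D.f i))
    (haE : ∀ i, a (E (D.f i)) = D.e i) : Function.Injective a := by
  classical
  rw [injective_iff_map_eq_zero]
  intro x hx
  obtain ⟨t, rfl⟩ := D.triangular_surjective F E hgen hcomm x
  have hF : ∀ u y, a (F u) y = u * y := by
    intro u y
    refine D.eq_of_words (LinearMap.applyₗ y ∘ₗ a.toLinearMap ∘ₗ F.toLinearMap)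
      (LinearMap.mulRight k y) (fun l => ?_) u
    simp only [LinearMap.comp_apply, LinearMap.applyₗ_apply_apply, AlgHom.toLinearMap_apply,
      LinearMap.mulRight_apply]
    induction l with
    | nil => simp
    | cons i l ih => rw [word_cons, map_mul, map_mul, Module.End.mul_apply, ih, haF, mul_assoc]; rfl
  have hE : ∀ w, (a.toLinearMap ∘ₗ E.toLinearMap) (D.word w) = D.eWord w := by
    intro w
    simp only [LinearMap.comp_apply, AlgHom.toLinearMap_apply]
    induction w with
    | nil => simp
    | cons i w ih => rw [word_cons, map_mul, map_mul, ih, haE, eWord_cons]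
  let b := Module.Basis.ofVectorSpace k U
  let c := TensorProduct.equivFinsuppOfBasisLeft (N := U) b t
  have htc : t = c.sum fun i v => b i ⊗ₜ v := by
    rw [← TensorProduct.equivFinsuppOfBasisLeft_symm_apply, LinearEquiv.symm_apply_apply]
  have hsum : ∀ y, (c.sum fun i v => b i * (a.toLinearMap ∘ₗ E.toLinearMap) v y) = 0 := by
    intro y
    have := LinearMap.congr_fun hx y
    rw [htc] at this
    simpa [Finsupp.sum, triangular, hF] using this
  have hc : c = 0 := by
    ext i
    exact D.eq_zero_of_ht fun m => D.ht_eq_zero_of_action hE b c hsum m i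
  rw [htc, hc]
  simp

end BosonDatum

section QuantumNumbers

lemma qv_ne_zero : qv ≠ 0 := RatFunc.X_ne_zero

lemma qv_zpow_eq_one {n : ℤ} (h : qv ^ n = 1) : n = 0 := by
  have key : ∀ m : ℕ, qv ^ m = 1 → m = 0 := by
    intro m hm
    have h1 : algebraMap (Polynomial ℚ) (RatFunc ℚ) (Polynomial.X ^ m) =
        algebraMap (Polynomial ℚ) (RatFunc ℚ) 1 := by
      rw [map_pow, map_one, RatFunc.algebraMap_X]
      exact hm
    have h2 := congrArg Polynomial.natDegree (RatFunc.algebraMap_injective ℚ h1)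
    simpa using h2
  rcases Int.eq_nat_or_neg n with ⟨m, rfl | rfl⟩
  · rw [zpow_natCast] at h
    simp [key m h]
  · rw [zpow_neg, zpow_natCast, inv_eq_one] at h
    simp [key m h]

lemma qd_ne_zero (A : GCM I) (i : I) : qd A i ≠ 0 := zpow_ne_zero _ qv_ne_zero

lemma qd_zpow_eq_one {A : GCM I} {i : I} {n : ℤ} (h : qd A i ^ n = 1) : n = 0 := by
  rw [qd, ← zpow_mul] at h
  exact (mul_eq_zero.mp (qv_zpow_eq_one h)).resolve_left (A.d_pos i).ne'

lemma qd_pow_sub_ne_zero (A : GCM I) (i : I) (n : ℕ) :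
    qd A i ^ (n + 1) - (qd A i)⁻¹ ^ (n + 1) ≠ 0 := by
  intro h
  have h1 : qd A i ^ ((n + 1 : ℕ) + (n + 1 : ℕ) : ℤ) = 1 := by
    rw [zpow_add₀ (qd_ne_zero A i), zpow_natCast]
    nth_rewrite 1 [sub_eq_zero.mp h]
    rw [← mul_pow, inv_mul_cancel₀ (qd_ne_zero A i), one_pow]
  have := qd_zpow_eq_one h1
  omega

lemma qNum_ne_zero (A : GCM I) (i : I) (n : ℕ) : qNum (qd A i) (n + 1) ≠ 0 :=
  div_ne_zero (qd_pow_sub_ne_zero A i n) (by simpa using qd_pow_sub_ne_zero A i 0)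

lemma qFact_ne_zero (A : GCM I) (i : I) (n : ℕ) : qFact (qd A i) n ≠ 0 :=
  Finset.prod_ne_zero_iff.mpr fun _ _ => qNum_ne_zero A i _

lemma qFact_succ (t : 𝕂) (n : ℕ) : qFact t (n + 1) = qFact t n * qNum t (n + 1) :=
  Finset.prod_range_succ _ _

lemma qNum_add {t : 𝕂} (ht : t ≠ 0) (m s : ℕ) :
    qNum t (m + s) = t⁻¹ ^ m * qNum t s + t ^ s * qNum t m := by
  have h : t ^ m * t⁻¹ ^ m = 1 := by rw [← mul_pow, mul_inv_cancel₀ ht, one_pow]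
  have h' : t ^ s * t⁻¹ ^ s = 1 := by rw [← mul_pow, mul_inv_cancel₀ ht, one_pow]
  simp only [qNum, pow_add]
  ring

lemma qBinom_symm (t : 𝕂) {n k : ℕ} (h : k ≤ n) : qBinom t n (n - k) = qBinom t n k := by
  rw [qBinom, qBinom, Nat.sub_sub_self h, mul_comm]

lemma qBinom_zero (A : GCM I) (i : I) (n : ℕ) : qBinom (qd A i) n 0 = 1 := by
  have := qFact_ne_zero A i n
  rw [qBinom, Nat.sub_zero, show qFact (qd A i) 0 = 1 from rfl, one_mul, div_self this]

lemma qBinom_self (A : GCM I) (i : I) (n : ℕ) : qBinom (qd A i) n n = 1 := by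
  have := qBinom_symm (qd A i) (Nat.zero_le n)
  rwa [Nat.sub_zero, qBinom_zero] at this

/-- The quantum Pascal identity. -/
lemma qBinom_succ (A : GCM I) (i : I) (k r : ℕ) :
    qBinom (qd A i) (k + 1 + r + 1) (k + 1) =
      (qd A i)⁻¹ ^ (k + 1) * qBinom (qd A i) (k + 1 + r) (k + 1) +
        qd A i ^ (r + 1) * qBinom (qd A i) (k + 1 + r) k := by
  have h1 := qFact_ne_zero A i k
  have h2 := qFact_ne_zero A i r
  have h3 := qNum_ne_zero A i k
  have h4 := qNum_ne_zero A i r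
  have h5 := qNum_add (qd_ne_zero A i) (k + 1) (r + 1)
  rw [qBinom, qBinom, qBinom, show k + 1 + r + 1 - (k + 1) = r + 1 by omega,
    show k + 1 + r - (k + 1) = r by omega, show k + 1 + r - k = r + 1 by omega,
    qFact_succ _ (k + 1 + r), qFact_succ _ k, qFact_succ _ r,
    show k + 1 + r + 1 = k + 1 + (r + 1) by omega, h5]
  field_simp

/-- The quantum binomial coefficient, extended by zero. -/
def qChoose (t : 𝕂) (n k : ℕ) : 𝕂 := if k ≤ n then qBinom t n k else 0

lemma qChoose_succ (A : GCM I) (i : I) (n k : ℕ) :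
    qChoose (qd A i) (n + 1) (k + 1) = qd A i ^ (-(k + 1) : ℤ) * qChoose (qd A i) n (k + 1) +
      qd A i ^ (n - k : ℤ) * qChoose (qd A i) n k := by
  rcases lt_trichotomy k n with h | rfl | h
  · obtain ⟨r, rfl⟩ := Nat.exists_eq_add_of_le (Nat.succ_le_of_lt h)
    rw [qChoose, qChoose, qChoose, if_pos (by omega), if_pos (by omega), if_pos (by omega),
      Nat.succ_eq_add_one, qBinom_succ, zpow_neg, inv_pow]
    congr 2
    rw [← zpow_natCast]
    congr 1
    push_cast
    ring
  · simp [qChoose, qBinom_self]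
  · simp [qChoose, h.not_ge, show ¬ k + 1 ≤ n by omega]

end QuantumNumbers

section Serre

lemma map_serreIn {R S : Type} [Ring R] [Algebra 𝕂 R] [Ring S] [Algebra 𝕂 S] (φ : R →ₐ[𝕂] S)
    (A : GCM I) (i j : I) (a b : R) : φ (serreIn A i j a b) = serreIn A i j (φ a) (φ b) := by
  simp [serreIn]

lemma sum_reverse_eq_serreIn {R : Type} [Ring R] [Algebra 𝕂 R] (A : GCM I) (i j : I) (a b : R) :
    ∑ k ∈ Finset.range ((1 - A.c i j).toNat + 1),
      ((-1 : 𝕂) ^ k * qBinom (qd A i) ((1 - A.c i j).toNat) k) •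
        (a ^ ((1 - A.c i j).toNat - k) * b * a ^ k) =
      (-1 : 𝕂) ^ (1 - A.c i j).toNat • serreIn A i j a b := by
  rw [serreIn, Finset.smul_sum, ← Finset.sum_range_reflect]
  refine Finset.sum_congr rfl fun k hk => ?_
  have hk' : k ≤ (1 - A.c i j).toNat := by
    have := Finset.mem_range.mp hk
    omega
  generalize (1 - A.c i j).toNat = n at hk'
  rw [show n + 1 - 1 - k = n - k by omega, qBinom_symm _ hk', Nat.sub_sub_self hk', smul_smul,
    ← mul_assoc]
  congr 2
  obtain ⟨r, rfl⟩ := Nat.exists_eq_add_of_le hk'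
  rw [Nat.add_sub_cancel_left, pow_add, mul_right_comm, ← mul_pow]
  simp

/-- The algebra homomorphism out of `Uq A` determined by the images of the generators. -/
def uqLift {R : Type} [Ring R] [Algebra 𝕂 R] (A : GCM I) (g : I → R)
    (h : ∀ i j, i ≠ j → serreIn A i j (g i) (g j) = 0) : Uq A →ₐ[𝕂] R :=
  RingQuot.liftAlgHom 𝕂 ⟨FreeAlgebra.lift 𝕂 g, by
    rintro _ _ ⟨i, j, hij⟩
    rw [map_serreIn, map_zero, FreeAlgebra.lift_ι_apply, FreeAlgebra.lift_ι_apply, h i j hij]⟩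

lemma uqLift_fg {R : Type} [Ring R] [Algebra 𝕂 R] (A : GCM I) (g : I → R)
    (h : ∀ i j, i ≠ j → serreIn A i j (g i) (g j) = 0) (i : I) : uqLift A g h (fg A i) = g i := by
  rw [uqLift, fg, RingQuot.liftAlgHom_mkAlgHom_apply, FreeAlgebra.lift_ι_apply]

lemma serreIn_fg (A : GCM I) {i j : I} (h : i ≠ j) : serreIn A i j (fg A i) (fg A j) = 0 := by
  rw [fg, fg, ← map_serreIn, ← map_zero (RingQuot.mkAlgHom 𝕂 (URel A))]
  exact RingQuot.mkAlgHom_rel 𝕂 (URel.serre i j h)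

end Serre

section Structure

lemma span_words_fg (A : GCM I) :
    Submodule.span 𝕂 (Set.range fun l : List I => (l.map (fg A)).prod) = ⊤ := by
  rw [eq_top_iff]
  intro x _
  obtain ⟨y, rfl⟩ := RingQuot.mkAlgHom_surjective 𝕂 (URel A) x
  induction y using FreeAlgebra.induction with
  | grade0 r =>
    rw [AlgHom.commutes, Algebra.algebraMap_eq_smul_one]
    exact Submodule.smul_mem _ _ (Submodule.subset_span ⟨[], rfl⟩)
  | grade1 i => exact Submodule.subset_span ⟨[i], by simp [fg]⟩
  | mul a b ha hb =>
    rw [map_mul]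
    have hmul := Submodule.mul_mem_mul (ha trivial) (hb trivial)
    rw [Submodule.span_mul_span] at hmul
    refine Submodule.span_mono ?_ hmul
    rintro _ ⟨_, ⟨l, rfl⟩, _, ⟨m, rfl⟩, rfl⟩
    exact ⟨l ++ m, by simp⟩
  | add a b ha hb =>
    rw [map_add]
    exact Submodule.add_mem _ (ha trivial) (hb trivial)

/-- The coaction recording the weight of an element. -/
def uqGrade (A : GCM I) : Uq A →ₐ[𝕂] AddMonoidAlgebra (Uq A) (Multiset I) :=
  uqLift (R := AddMonoidAlgebra (Uq A) (Multiset I)) A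
    (fun i => AddMonoidAlgebra.single {i} (fg A i)) fun i j hij => by
    have : serreIn A i j (AddMonoidAlgebra.single ({i} : Multiset I) (fg A i))
        (AddMonoidAlgebra.single {j} (fg A j)) =
        AddMonoidAlgebra.lsingle (R := 𝕂) ((1 - A.c i j).toNat • {i} + {j})
          (serreIn A i j (fg A i) (fg A j)) := by
      simp only [serreIn, map_sum, map_smul]
      refine Finset.sum_congr rfl fun k hk => ?_
      rw [AddMonoidAlgebra.single_pow, AddMonoidAlgebra.single_pow,
        AddMonoidAlgebra.single_mul_single, AddMonoidAlgebra.single_mul_single,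
        AddMonoidAlgebra.lsingle_apply]
      congr 2
      rw [add_right_comm, ← add_smul]
      congr 2
      have := Finset.mem_range.mp hk
      omega
    rw [this, serreIn_fg A hij, map_zero]

lemma uqGrade_word (A : GCM I) (l : List I) :
    uqGrade A (l.map (fg A)).prod = AddMonoidAlgebra.single (l : Multiset I) (l.map (fg A)).prod := by
  induction l with
  | nil => simp [AddMonoidAlgebra.one_def]
  | cons i l ih =>
    rw [List.map_cons, List.prod_cons, map_mul, ih, uqGrade, uqLift_fg,
      AddMonoidAlgebra.single_mul_single, ← Multiset.cons_coe, Multiset.singleton_add]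

/-- Multiplication of each weight component by a scalar. -/
def uqScale (A : GCM I) (κ : Multiset I → 𝕂) : Uq A →ₗ[𝕂] Uq A :=
  Finsupp.lsum 𝕂 (fun β => κ β • LinearMap.id) ∘ₗ
    (AddMonoidAlgebra.coeffLinearEquiv 𝕂).toLinearMap ∘ₗ (uqGrade A).toLinearMap

lemma uqScale_apply (A : GCM I) (κ : Multiset I → 𝕂) (u : Uq A) :
    uqScale A κ u = (uqGrade A u).coeff.sum fun β v => κ β • v := rfl

lemma uqScale_word (A : GCM I) (κ : Multiset I → 𝕂) (l : List I) :
    uqScale A κ (l.map (fg A)).prod = κ l • (l.map (fg A)).prod := by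
  rw [uqScale_apply, uqGrade_word, AddMonoidAlgebra.coeff_single, Finsupp.sum_single_index]
  simp

lemma uqScale_separated (A : GCM I) (x : Uq A)
    (h : ∀ β, uqScale A (fun γ => if γ = β then 1 else 0) x = 0) : x = 0 := by
  have h0 : (uqGrade A x).coeff = 0 := by
    ext β
    have := h β
    rw [uqScale_apply, Finsupp.sum] at this
    simpa [ite_smul] using this
  have h1 : uqScale A (fun _ => 1) = LinearMap.id :=
    LinearMap.ext_on_range (span_words_fg A) fun l => by rw [uqScale_word]; simp
  have h2 := LinearMap.congr_fun h1 x
  rw [uqScale_apply, h0, Finsupp.sum_zero_index] at h2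
  exact h2.symm

/-- The reversal of words. -/
def uqStar (A : GCM I) : Uq A →ₗ[𝕂] Uq A :=
  (MulOpposite.opLinearEquiv 𝕂).symm.toLinearMap ∘ₗ
    (uqLift A (fun i => MulOpposite.op (fg A i)) fun i j hij => by
      apply MulOpposite.unop_injective
      have := sum_reverse_eq_serreIn A i j (fg A i) (fg A j)
      rw [serreIn_fg A hij, smul_zero] at this
      rw [MulOpposite.unop_zero, ← this, serreIn, Finset.unop_sum]
      refine Finset.sum_congr rfl fun k _ => ?_
      simp [mul_assoc]).toLinearMap

lemma uqStar_word (A : GCM I) (l : List I) :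
    uqStar A (l.map (fg A)).prod = (l.reverse.map (fg A)).prod := by
  simp only [uqStar, LinearMap.comp_apply, AlgHom.toLinearMap_apply]
  induction l with
  | nil => simp
  | cons i l ih =>
    simp only [List.map_cons, List.prod_cons, map_mul, uqLift_fg, List.reverse_cons,
      List.map_append, List.prod_append, ← ih]
    simp

/-- The counit. -/
def uqCounit (A : GCM I) : Uq A →ₐ[𝕂] 𝕂 :=
  uqLift A (fun _ => 0) fun i j _ => by simp [serreIn]

lemma uqCounit_word (A : GCM I) (l : List I) :
    uqCounit A (l.map (fg A)).prod = if l = [] then 1 else 0 := by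
  cases l with
  | nil => simp
  | cons i l => simp [uqCounit, uqLift_fg]

/-- The `q`-commutator with `f i`. -/
def uqAd (A : GCM I) (i : I) : Module.End 𝕂 (Uq A) :=
  LinearMap.mulLeft 𝕂 (fg A i) - LinearMap.mulRight 𝕂 (fg A i) ∘ₗ
    uqScale A (fun β => qv ^ (β.map fun j => A.d i * A.c i j).sum)

lemma uqAd_monomial (A : GCM I) (i j : I) (r s : ℕ) :
    uqAd A i (fg A i ^ r * fg A j * fg A i ^ s) = fg A i ^ (r + 1) * fg A j * fg A i ^ s -
      qd A i ^ (2 * (r + s : ℕ) + A.c i j : ℤ) • (fg A i ^ r * fg A j * fg A i ^ (s + 1)) := by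
  have h := uqScale_word A (fun β => qv ^ (β.map fun j => A.d i * A.c i j).sum)
    (List.replicate r i ++ j :: List.replicate s i)
  have hw : ((List.replicate r i ++ j :: List.replicate s i).map (fg A)).prod =
      fg A i ^ r * fg A j * fg A i ^ s := by simp [mul_assoc]
  rw [hw] at h
  rw [uqAd, LinearMap.sub_apply, LinearMap.comp_apply, h, LinearMap.mulLeft_apply,
    LinearMap.mulRight_apply, smul_mul_assoc, pow_succ', pow_succ, ← mul_assoc, ← mul_assoc,
    ← mul_assoc, qd, ← zpow_mul]
  congr 3
  simp [A.diag]
  ring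

lemma pow_apply_of_apply_monomial {R : Type} [Ring R] [Algebra 𝕂 R] (A : GCM I) (i j : I)
    (T : Module.End 𝕂 R) (x y : R) (hT : ∀ r s : ℕ, T (x ^ r * y * x ^ s) =
      x ^ (r + 1) * y * x ^ s -
        qd A i ^ (2 * (r + s : ℕ) + A.c i j : ℤ) • (x ^ r * y * x ^ (s + 1))) (n : ℕ) : (T ^ n) y =
    ∑ k ∈ Finset.range (n + 1), ((-1 : 𝕂) ^ k * (qChoose (qd A i) n k *
      qd A i ^ (k * (A.c i j + n - 1) : ℤ))) • (x ^ (n - k) * y * x ^ k) := by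
  induction n with
  | zero => simp [qChoose, qBinom_zero]
  | succ n ih =>
    rw [pow_succ', Module.End.mul_apply, ih, map_sum]
    have h1 : ∀ k ∈ Finset.range (n + 1), T (((-1 : 𝕂) ^ k * (qChoose (qd A i) n k *
        qd A i ^ (k * (A.c i j + n - 1) : ℤ))) • (x ^ (n - k) * y * x ^ k)) =
        ((-1 : 𝕂) ^ k * (qChoose (qd A i) n k * qd A i ^ (k * (A.c i j + n - 1) : ℤ))) •
          (x ^ (n + 1 - k) * y * x ^ k) -
        ((-1 : 𝕂) ^ k * (qChoose (qd A i) n k * qd A i ^ (k * (A.c i j + n - 1) : ℤ)) *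
          qd A i ^ (2 * n + A.c i j : ℤ)) • (x ^ (n - k) * y * x ^ (k + 1)) := by
      intro k hk
      have hk' := Finset.mem_range.mp hk
      rw [map_smul, hT, smul_sub, smul_smul, Nat.sub_add_cancel (by omega : k ≤ n),
        show n - k + 1 = n + 1 - k by omega]
    rw [Finset.sum_congr rfl h1, Finset.sum_sub_distrib]
    have h2 : ∀ F : ℕ → R, (∑ k ∈ Finset.range (n + 1), ((-1 : 𝕂) ^ k * (qChoose (qd A i) n k *
        qd A i ^ (k * (A.c i j + n - 1) : ℤ))) • F k) =
        ∑ k ∈ Finset.range (n + 1), ((-1 : 𝕂) ^ (k + 1) * (qChoose (qd A i) n (k + 1) *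
        qd A i ^ ((k + 1 : ℕ) * (A.c i j + n - 1) : ℤ))) • F (k + 1) + F 0 := by
      intro F
      have h3 := Finset.sum_range_succ' (fun k => ((-1 : 𝕂) ^ k * (qChoose (qd A i) n k *
        qd A i ^ (k * (A.c i j + n - 1) : ℤ))) • F k) (n + 1)
      rw [Finset.sum_range_succ] at h3
      simpa [qChoose, qBinom_zero] using h3
    rw [h2 fun k => x ^ (n + 1 - k) * y * x ^ k, Finset.sum_range_succ' _ (n + 1),
      add_sub_right_comm, ← Finset.sum_sub_distrib]
    congr 1
    · refine Finset.sum_congr rfl fun k hk => ?_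
      rw [show n + 1 - (k + 1) = n - k by omega, ← sub_smul, qChoose_succ]
      congr 1
      have ht := qd_ne_zero A i
      have e1 : qd A i ^ ((k + 1 : ℕ) * (A.c i j + (n + 1 : ℕ) - 1) : ℤ) * qd A i ^ (-(k + 1) : ℤ) =
          qd A i ^ ((k + 1 : ℕ) * (A.c i j + n - 1) : ℤ) := by
        rw [← zpow_add₀ ht]
        congr 1
        push_cast
        ring
      have e2 : qd A i ^ ((k + 1 : ℕ) * (A.c i j + (n + 1 : ℕ) - 1) : ℤ) * qd A i ^ (n - k : ℤ) =
          qd A i ^ (k * (A.c i j + n - 1) : ℤ) * qd A i ^ (2 * n + A.c i j : ℤ) := by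
        rw [← zpow_add₀ ht, ← zpow_add₀ ht]
        congr 1
        push_cast
        ring
      rw [← e1, pow_succ]
      linear_combination (-1 : 𝕂) ^ k * qChoose (qd A i) n k * e2
    · simp [qChoose, qBinom_zero]

lemma uqAd_nilpotent (A : GCM I) {i j : I} (hij : i ≠ j) :
    (uqAd A i ^ (1 - A.c i j).toNat) (fg A j) = 0 := by
  have hn : ((1 - A.c i j).toNat : ℤ) = 1 - A.c i j := by
    have := A.offdiag i j hij
    omega
  have h := sum_reverse_eq_serreIn A i j (fg A i) (fg A j)
  rw [serreIn_fg A hij, smul_zero] at h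
  rw [pow_apply_of_apply_monomial A i j _ _ _ (uqAd_monomial A i j), ← h]
  refine Finset.sum_congr rfl fun k hk => ?_
  have hk' := Finset.mem_range.mp hk
  rw [hn, qChoose, if_pos (by omega)]
  simp

/-- The structure carried by the negative half of the quantum group. -/
def uqDatum (A : GCM I) (e' : I → Module.End 𝕂 (Uq A)) (he'one : ∀ i, e' i 1 = 0)
    (he'f : ∀ i j u, e' i (fg A j * u) =
      (if i = j then u else 0) + qv ^ (-(A.d i * A.c i j)) • (fg A j * e' i u)) :
    BosonDatum 𝕂 (Uq A) I where
  q := qv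
  q_ne := qv_ne_zero
  q_pow _ := qv_zpow_eq_one
  p i j := A.d i * A.c i j
  p_symm := A.dsymm
  p_pos i := by
    rw [A.diag]
    have := A.d_pos i
    omega
  f := fg A
  span_words := span_words_fg A
  scale := uqScale A
  scale_words := uqScale_word A
  separated := uqScale_separated A
  star := uqStar A
  star_words := uqStar_word A
  counit := (uqCounit A).toLinearMap
  counit_words := uqCounit_word A
  e := e'
  e_one := he'one
  e_f_mul := he'f
  nilpotent i j hij := ⟨_, uqAd_nilpotent A hij⟩

lemma serreIn_e {R : Type} [Ring R] [Algebra 𝕂 R] (D : BosonDatum 𝕂 R I) (A : GCM I) {i j : I}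
    (h : serreIn A i j (D.f i) (D.f j) = 0) : serreIn A i j (D.e i) (D.e j) = 0 := by
  have hword : ∀ r s, D.word (List.replicate r i ++ j :: List.replicate s i) =
      D.f i ^ r * D.f j * D.f i ^ s := by
    intro r s
    simp [BosonDatum.word, mul_assoc]
  have heWord : ∀ r s, D.eWord (List.replicate r i ++ j :: List.replicate s i).reverse =
      D.e i ^ s * D.e j * D.e i ^ r := by
    intro r s
    simp [BosonDatum.eWord, mul_assoc]
  have h := D.sum_eWord_reverse_eq_zero (Finset.range ((1 - A.c i j).toNat + 1))
    (fun k => (-1 : 𝕂) ^ k * qBinom (qd A i) ((1 - A.c i j).toNat) k)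
    (fun k => List.replicate k i ++ j :: List.replicate ((1 - A.c i j).toNat - k) i)
    (by simp only [hword]; exact h)
  simp only [heWord] at h
  rw [sum_reverse_eq_serreIn] at h
  exact (smul_eq_zero.mp h).resolve_left (pow_ne_zero _ (by simp))

end Structure

section Presentation

lemma bgen_comm (A : GCM I) (i j : I) : bgen A (Sum.inl i) * bgen A (Sum.inr j) =
    qv ^ (-(A.d i * A.c i j)) • (bgen A (Sum.inr j) * bgen A (Sum.inl i)) +
      if i = j then 1 else 0 := by
  have := RingQuot.mkAlgHom_rel 𝕂 (BRel.ef (A := A) i j)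
  simp only [map_add, map_mul, map_smul] at this
  rw [bgen, bgen, this]
  split_ifs <;> simp

lemma serreIn_bgen_inl (A : GCM I) (i j : I) (h : i ≠ j) :
    serreIn A i j (bgen A (Sum.inl i)) (bgen A (Sum.inl j)) = 0 := by
  rw [bgen, bgen, ← map_serreIn, ← map_zero (RingQuot.mkAlgHom 𝕂 (BRel A))]
  exact RingQuot.mkAlgHom_rel 𝕂 (BRel.serreE i j h)

lemma serreIn_bgen_inr (A : GCM I) (i j : I) (h : i ≠ j) :
    serreIn A i j (bgen A (Sum.inr i)) (bgen A (Sum.inr j)) = 0 := by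
  rw [bgen, bgen, ← map_serreIn, ← map_zero (RingQuot.mkAlgHom 𝕂 (BRel A))]
  exact RingQuot.mkAlgHom_rel 𝕂 (BRel.serreF i j h)

lemma adjoin_bgen (A : GCM I) : Algebra.adjoin 𝕂 (Set.range (bgen A)) = ⊤ := by
  have : Set.range (bgen A) = RingQuot.mkAlgHom 𝕂 (BRel A) '' Set.range (FreeAlgebra.ι 𝕂) := by
    rw [← Set.range_comp]
    rfl
  rw [this, ← AlgHom.map_adjoin, FreeAlgebra.adjoin_range_ι, Algebra.map_top]
  exact (AlgHom.range_eq_top _).mpr (RingQuot.mkAlgHom_surjective 𝕂 (BRel A))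

end Presentation

/-- the natural surjection from the presented algebra onto `B_q(g)`, sending
`e_i'` to `e_i'` and `f_i` to left multiplication by `f_i`, exists and is an isomorphism
onto `B_q(g)` (injective with range exactly `B_q(g)`).  The operators `e_i'` are
characterized as in the context. -/
theorem statement1 (A : GCM I) (e' : I → Module.End 𝕂 (Uq A))
    (he'one : ∀ i, e' i 1 = 0)
    (he'f : ∀ i j u, e' i (fg A j * u) =
      (if i = j then u else 0) + qv ^ (-(A.d i * A.c i j)) • (fg A j * e' i u)) :
    ∃ a : Bpres A →ₐ[𝕂] Module.End 𝕂 (Uq A),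
      (∀ i, a (bgen A (Sum.inl i)) = e' i) ∧
      (∀ i, a (bgen A (Sum.inr i)) = LinearMap.mul 𝕂 (Uq A) (fg A i)) ∧
      Function.Injective a ∧ a.range = Bqg A e' := by
  let g : I ⊕ I → Module.End 𝕂 (Uq A) := Sum.elim e' fun i => LinearMap.mul 𝕂 (Uq A) (fg A i)
  have hrel : ∀ ⦃x y⦄, BRel A x y → FreeAlgebra.lift 𝕂 g x = FreeAlgebra.lift 𝕂 g y := by
    rintro _ _ (⟨i, j⟩ | ⟨i, j, hij⟩ | ⟨i, j, hij⟩)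
    · refine LinearMap.ext fun u => ?_
      simp only [map_mul, map_add, map_smul, FreeAlgebra.lift_ι_apply, g, Sum.elim_inl,
        Sum.elim_inr, Module.End.mul_apply, LinearMap.mul_apply', he'f, LinearMap.add_apply,
        LinearMap.smul_apply]
      rw [add_comm]
      split_ifs <;> simp
    · rw [map_zero]
      refine (map_serreIn (S := Module.End 𝕂 (Uq A)) (FreeAlgebra.lift 𝕂 g) A i j _ _).trans ?_
      rw [FreeAlgebra.lift_ι_apply, FreeAlgebra.lift_ι_apply]
      have h := map_serreIn (S := Module.End 𝕂 (Uq A)) (Algebra.lmul 𝕂 (Uq A)) A i j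
        (fg A i) (fg A j)
      rw [serreIn_fg A hij, map_zero] at h
      exact h.symm
    · rw [map_zero]
      refine (map_serreIn (S := Module.End 𝕂 (Uq A)) (FreeAlgebra.lift 𝕂 g) A i j _ _).trans ?_
      rw [FreeAlgebra.lift_ι_apply, FreeAlgebra.lift_ι_apply]
      exact serreIn_e (uqDatum A e' he'one he'f) A (serreIn_fg A hij)
  let a : Bpres A →ₐ[𝕂] Module.End 𝕂 (Uq A) := RingQuot.liftAlgHom 𝕂 ⟨FreeAlgebra.lift 𝕂 g, hrel⟩
  have ha : ∀ x, a (bgen A x) = g x := fun x => by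
    rw [bgen, RingQuot.liftAlgHom_mkAlgHom_apply, FreeAlgebra.lift_ι_apply]
  refine ⟨a, fun i => ha _, fun i => ha _, ?_, ?_⟩
  · let F := uqLift A (fun i => bgen A (Sum.inr i)) (serreIn_bgen_inr A)
    let E := uqLift A (fun i => bgen A (Sum.inl i)) (serreIn_bgen_inl A)
    have hF : ∀ i, F (fg A i) = bgen A (Sum.inr i) := uqLift_fg A _ _
    have hE : ∀ i, E (fg A i) = bgen A (Sum.inl i) := uqLift_fg A _ _
    refine (uqDatum A e' he'one he'f).injective_of_triangular F E ?_ ?_ a ?_ ?_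
    · change Algebra.adjoin 𝕂 (Set.range (fun i => F (fg A i)) ∪
        Set.range (fun i => E (fg A i))) = ⊤
      simp only [hF, hE]
      rw [← adjoin_bgen A, Set.union_comm]
      congr 1
      ext x
      simp
    · intro i j
      change E (fg A i) * F (fg A j) = qv ^ (-(A.d i * A.c i j)) • (F (fg A j) * E (fg A i)) + _
      rw [hE, hF, bgen_comm]
    · intro i
      change a (F (fg A i)) = _
      rw [hF, ha]
      rfl
    · intro i
      change a (E (fg A i)) = _
      rw [hE, ha]
      rfl
  · rw [← Algebra.map_top, ← adjoin_bgen A, AlgHom.map_adjoin, Bqg, ← Set.range_comp]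
    congr 1
    ext x
    simp only [Function.comp_def, ha, g, Set.mem_range, Sum.exists, Sum.elim_inl, Sum.elim_inr,
      Set.mem_union]
    exact or_comm

end
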